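/- arXiv:1804.05431 — 2 statements merged into one kernel-verified Lean document; each statement's English description precedes it below -/
import Mathlib

section
/- Let g > 1 be an integer and set n = 2g − 2. Then | 2^{n−1} · n! · Σ_{μ ∈ Y_{n+2}, all parts of μ even} (−1)^{ℓ(μ)−1} / ((2n − ℓ(μ) + 2)! · ∏_{i≥1} M_i(μ)!) · ∏_{i=1}^{ℓ(μ)} (2μ_i − 3)!! · 𝔷(μ_i) − 1 | ≤ 2^{20} / g. (By an identity of Eskin–Okounkov, the quantity inside the absolute value equals 2^{2g−4} ν₁(H₁(1^{2g−2})) − 1, so this establishes the large-genus asymptotics of the Masur–Veech volume of the principal stratum.) -/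
open Nat Finset
open scoped Nat

/-- The series `ζ(k) = Σ_{j=1}^∞ j^{−k}` (convergent for `k ≥ 2`). -/
noncomputable def zetaSeries (k : ℤ) : ℝ :=
  ∑' j : ℕ, ((j : ℝ) + 1) ^ (-k)

/-- `𝔷(k) = (2 − 2^{2−k}) ζ(k)` for even integers `k ≥ 2`, `𝔷(0) = 1`, and `𝔷(k) = 0`
for all other integers `k` (in particular for odd or negative `k`). -/
noncomputable def zed (k : ℤ) : ℝ :=
  if k = 0 then 1
  else if 2 ≤ k ∧ Even k then (2 - (2 : ℝ) ^ (2 - k)) * zetaSeries k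
  else 0

/-- The double factorials `(4m - 3)‼`, extended by `0` at `m = 0`. -/
def oddDouble : ℕ → ℝ
  | 0 => 0
  | m + 1 => ((4 * m + 1)‼ : ℕ)

theorem oddDouble_nonneg (m : ℕ) : 0 ≤ oddDouble m := by
  cases m <;> simp [oddDouble]

theorem oddDouble_add_two (m : ℕ) :
    oddDouble (m + 2) = (4 * m + 5) * (4 * m + 3) * oddDouble (m + 1) := by
  have h : 4 * (m + 1) + 1 = (4 * m + 1) + 2 + 2 := by ring
  simp only [oddDouble, h, Nat.doubleFactorial_add_two]
  push_cast
  ring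

theorem oddDouble_mul_le (i j : ℕ) :
    oddDouble (i + 2) * oddDouble (j + 2) ≤ 15 * oddDouble (i + j + 2) := by
  induction i with
  | zero =>
    have : oddDouble 2 = 15 := by norm_num [oddDouble, Nat.doubleFactorial]
    simp [this]
  | succ i ih =>
    have e : i + 1 + j + 2 = (i + j + 1) + 2 := by ring
    rw [e, oddDouble_add_two (i + 1), oddDouble_add_two (i + j + 1), add_assoc i 1 1,
      add_assoc (i + j) 1 1, one_add_one_eq_two]
    push_cast
    have h2 := oddDouble_nonneg (i + j + 2)
    have h3 := oddDouble_nonneg (j + 2)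
    have h4 := oddDouble_nonneg (i + 2)
    have h5 : (4 * ((i : ℝ) + 1) + 5) * (4 * (i + 1) + 3) ≤
        (4 * ((i : ℝ) + j + 1) + 5) * (4 * (i + j + 1) + 3) := by
      gcongr <;> linarith [(j.cast_nonneg : (0 : ℝ) ≤ j)]
    calc _ = (4 * ((i : ℝ) + 1) + 5) * (4 * (i + 1) + 3) *
          (oddDouble (i + 2) * oddDouble (j + 2)) := by ring
      _ ≤ (4 * ((i : ℝ) + j + 1) + 5) * (4 * (i + j + 1) + 3) *
          (15 * oddDouble (i + j + 2)) := by gcongr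
      _ = _ := by ring

/-- Convolving the double factorials with themselves costs one step of the argument. -/
theorem sum_antidiagonal_oddDouble_le (k : ℕ) :
    ∑ p ∈ antidiagonal k, oddDouble p.1 * oddDouble p.2 ≤ 9 / 4 * oddDouble (k - 1) := by
  match k with
  | 0 => simp [oddDouble]
  | 1 => simp [oddDouble, Finset.Nat.antidiagonal_succ]
  | 2 => norm_num [oddDouble, Finset.Nat.antidiagonal_succ]
  | 3 => norm_num [oddDouble, Finset.Nat.antidiagonal_succ, Nat.doubleFactorial]
  | k + 4 =>
    rw [Finset.Nat.antidiagonal_succ_succ', Finset.sum_cons, Finset.sum_cons, Finset.sum_map,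
      Finset.Nat.antidiagonal_succ_succ', Finset.sum_cons, Finset.sum_cons, Finset.sum_map]
    have h : ∑ p ∈ antidiagonal k, oddDouble (p.1 + 1 + 1) * oddDouble (p.2 + 1 + 1) ≤
        ∑ p ∈ antidiagonal k, 15 * oddDouble (k + 2) := by
      refine Finset.sum_le_sum fun p hp => ?_
      rw [← Finset.HasAntidiagonal.mem_antidiagonal.1 hp]
      exact oddDouble_mul_le p.1 p.2
    simp only [Finset.sum_const, Finset.Nat.card_antidiagonal, nsmul_eq_mul] at h
    have h1 : oddDouble 1 = 1 := by simp [oddDouble]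
    have h0 : oddDouble 0 = 0 := rfl
    have h2 := oddDouble_nonneg (k + 2)
    have h3 := oddDouble_add_two (k + 1)
    simp [h0, h1] at h h3 ⊢
    have hk : (0 : ℝ) ≤ k := k.cast_nonneg
    nlinarith [mul_nonneg h2 hk, mul_nonneg h2 (mul_nonneg hk hk)]

/-- The second bound is `η(k) ≤ 1` for the Dirichlet eta function. -/
theorem zetaSeries_bounds {k : ℕ} (hk : 2 ≤ k) :
    1 ≤ zetaSeries k ∧ (1 - 2 * (1 / 2 : ℝ) ^ k) * zetaSeries k ≤ 1 := by
  have hs : Summable fun j : ℕ => ((j : ℝ) + 1) ^ (-(k : ℤ)) := by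
    have := (summable_nat_add_iff 1).2 (Real.summable_nat_pow_inv.2 (by omega : 1 < k))
    simpa [zpow_neg] using this
  have hpos : ∀ j : ℕ, 0 ≤ ((j : ℝ) + 1) ^ (-(k : ℤ)) := fun j => by positivity
  constructor
  · have := hs.le_tsum 0 (fun j _ => hpos j)
    simpa [zetaSeries] using this
  · have hev : Summable fun j : ℕ => (((2 * j : ℕ) : ℝ) + 1 + 1) ^ (-(k : ℤ)) := by
      have := hs.comp_injective (i := fun j => 2 * j + 1) (fun a b h => by simpa using h)
      simpa [Function.comp_def] using this
    have hod : Summable fun j : ℕ => (((2 * j + 1 : ℕ) : ℝ) + 1 + 1) ^ (-(k : ℤ)) := by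
      have := hs.comp_injective (i := fun j => 2 * j + 2) (fun a b h => by simpa using h)
      simpa [Function.comp_def, add_assoc, one_add_one_eq_two] using this
    have hz : zetaSeries k = 1 + ∑' j : ℕ, (((j : ℕ) : ℝ) + 1 + 1) ^ (-(k : ℤ)) := by
      rw [zetaSeries, hs.tsum_eq_zero_add]
      simp
    have hsplit := tsum_even_add_odd (f := fun j : ℕ => ((j : ℝ) + 1 + 1) ^ (-(k : ℤ))) hev hod
    have hev' : ∀ j : ℕ, (((2 * j : ℕ) : ℝ) + 1 + 1) ^ (-(k : ℤ)) =
        (1 / 2 : ℝ) ^ k * ((j : ℝ) + 1) ^ (-(k : ℤ)) := fun j => by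
      rw [show (((2 * j : ℕ) : ℝ) + 1 + 1) = 2 * ((j : ℝ) + 1) by push_cast; ring, mul_zpow]
      simp [zpow_neg]
    have h1 : ∑' j : ℕ, (((2 * j : ℕ) : ℝ) + 1 + 1) ^ (-(k : ℤ)) =
        (1 / 2 : ℝ) ^ k * zetaSeries k := by
      simp_rw [hev', tsum_mul_left, zetaSeries]
    have h2 : ∑' j : ℕ, (((2 * j + 1 : ℕ) : ℝ) + 1 + 1) ^ (-(k : ℤ)) ≤
        ∑' j : ℕ, (((2 * j : ℕ) : ℝ) + 1 + 1) ^ (-(k : ℤ)) := by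
      refine hod.tsum_le_tsum (fun j => ?_) hev
      simp only [zpow_neg, zpow_natCast]
      gcongr
      linarith
    linarith

theorem zed_bounds {k : ℕ} (hk : 2 ≤ k) (he : Even k) :
    2 - 4 * (1 / 2 : ℝ) ^ k ≤ zed k ∧ zed k ≤ 2 := by
  obtain ⟨h1, h2⟩ := zetaSeries_bounds hk
  have e : zed k = 2 * ((1 - 2 * (1 / 2 : ℝ) ^ k) * zetaSeries k) := by
    rw [zed, if_neg (by omega), if_pos ⟨by omega, by exact_mod_cast he⟩, zpow_sub₀ (by norm_num)]
    simp
    ring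
  have h3 : (1 / 2 : ℝ) ^ k ≤ (1 / 2) ^ 2 := pow_le_pow_of_le_one (by norm_num) (by norm_num) hk
  rw [e]
  constructor <;> nlinarith

theorem coeff_pow_le {A : Polynomial ℝ} (h0 : ∀ m, 0 ≤ A.coeff m)
    (hA : ∀ m, A.coeff m ≤ 2 * oddDouble m) (l : ℕ) : ∀ m,
    0 ≤ (A ^ (l + 1)).coeff m ∧
      (A ^ (l + 1)).coeff m ≤ 2 * (9 / 2) ^ l * oddDouble (m - l) := by
  induction l with
  | zero => intro m; simpa using ⟨h0 m, hA m⟩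
  | succ l ih =>
    intro m
    rw [pow_succ, Polynomial.coeff_mul]
    refine ⟨Finset.sum_nonneg fun p _ => mul_nonneg (ih _).1 (h0 _), ?_⟩
    have key : ∑ p ∈ antidiagonal m, oddDouble (p.1 - l) * oddDouble p.2 ≤
        9 / 4 * oddDouble (m - (l + 1)) := by
      refine le_trans ?_ ((sum_antidiagonal_oddDouble_le (m - l)).trans_eq (by rw [Nat.sub_sub]))
      rcases lt_or_ge m l with hml | hml
      · refine (Finset.sum_eq_zero fun p hp => ?_).trans_le
          (Finset.sum_nonneg fun p _ => mul_nonneg (oddDouble_nonneg _) (oddDouble_nonneg _))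
        rw [Finset.HasAntidiagonal.mem_antidiagonal] at hp
        rw [Nat.sub_eq_zero_of_le (by omega)]
        simp [oddDouble]
      rw [← Finset.sum_filter_of_ne (p := fun p => l ≤ p.1)]
      · refine le_of_eq (Finset.sum_bij (fun p _ => (p.1 - l, p.2)) ?_ ?_ ?_ ?_)
        · intro p hp
          simp at hp ⊢
          omega
        · intro p hp q hq h
          simp at hp hq h
          exact Prod.ext (by omega) h.2
        · intro p hp
          refine ⟨(p.1 + l, p.2), ?_, by simp⟩
          simp at hp ⊢
          omega
        · intro p hp
          rfl
      · intro p _ h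
        by_contra hlt
        exact h (by rw [Nat.sub_eq_zero_of_le (by omega)]; simp [oddDouble])
    calc _ ≤ ∑ p ∈ antidiagonal m, 2 * (9 / 2) ^ l * oddDouble (p.1 - l) * (2 * oddDouble p.2) := by
          refine Finset.sum_le_sum fun p _ => ?_
          exact mul_le_mul (ih _).2 (hA _) (h0 _)
            (mul_nonneg (by positivity) (oddDouble_nonneg _))
      _ = 4 * (9 / 2) ^ l * ∑ p ∈ antidiagonal m, oddDouble (p.1 - l) * oddDouble p.2 := by
          rw [Finset.mul_sum]
          exact Finset.sum_congr rfl fun p _ => by ring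
      _ ≤ 4 * (9 / 2) ^ l * (9 / 4 * oddDouble (m - (l + 1))) := by gcongr
      _ = _ := by ring

theorem prod_factorial_count_mul_countPerms (m : Multiset ℕ) :
    (∏ i ∈ m.toFinset, (m.count i)!) * m.countPerms = (Multiset.card m)! := by
  have h := Nat.multinomial_spec m.toFinset m.count
  rw [Multiset.toFinset_sum_count_eq] at h
  rw [← h, Multiset.countPerms, Finsupp.multinomial_eq, Multiset.toFinsupp_support]
  rfl

/-- The generating polynomial of the even parts `p ≤ 2g`, with `p` marked by `X ^ (p / 2)`. -/
noncomputable def evenPartPoly (w : ℕ → ℝ) (g : ℕ) : Polynomial ℝ :=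
  ∑ p ∈ (Icc 1 g).image (2 * ·), Polynomial.monomial (p / 2) (w p)

theorem coeff_evenPartPoly (w : ℕ → ℝ) (g m : ℕ) :
    (evenPartPoly w g).coeff m = if m ∈ Icc 1 g then w (2 * m) else 0 := by
  rw [evenPartPoly, Finset.sum_image (fun a _ b _ h => by simpa using h)]
  simp [Polynomial.finsetSum_coeff, Polynomial.coeff_monomial]

theorem prod_map_monomial (w : ℕ → ℝ) (m : Multiset ℕ) :
    (m.map fun p => Polynomial.monomial (p / 2) (w p)).prod =
      Polynomial.monomial (m.map (· / 2)).sum (m.map w).prod := by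
  induction m using Multiset.induction_on with
  | empty => simp
  | cons a m ih => simp [ih, Polynomial.monomial_mul_monomial]

theorem two_mul_sum_map_half {m : Multiset ℕ} (h : ∀ p ∈ m, Even p) :
    2 * (m.map (· / 2)).sum = m.sum := by
  rw [← Multiset.sum_map_mul_left]
  conv_rhs => rw [← Multiset.map_id m]
  exact congrArg _ (Multiset.map_congr rfl fun p hp => Nat.two_mul_div_two_of_even (h p hp))

theorem sum_even_partitions_eq_coeff (w : ℕ → ℝ) (g l : ℕ) :
    ∑ μ ∈ (univ : Finset (Nat.Partition (2 * g))).filter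
        (fun μ => (∀ p ∈ μ.parts, Even p) ∧ Multiset.card μ.parts = l),
      (μ.parts.map w).prod / ∏ i ∈ μ.parts.toFinset, ((μ.parts.count i)! : ℝ) =
    (evenPartPoly w g ^ l).coeff g / l ! := by
  have hmem : ∀ p, p ∈ (Icc 1 g).image (2 * ·) ↔ 1 ≤ p ∧ p ≤ 2 * g ∧ Even p := by
    intro p
    simp only [Finset.mem_image, Finset.mem_Icc, even_iff_exists_two_mul]
    constructor
    · rintro ⟨a, ha, rfl⟩
      exact ⟨by omega, by omega, a, rfl⟩
    · rintro ⟨h1, h2, a, rfl⟩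
      exact ⟨a, by omega, rfl⟩
  have hcoeff : ∀ k : Sym ℕ l, k ∈ ((Icc 1 g).image (2 * ·)).sym l →
      ((k.val.countPerms : Polynomial ℝ) *
        (k.val.map fun p => Polynomial.monomial (p / 2) (w p)).prod).coeff g =
      if k.val.sum = 2 * g then (k.val.countPerms : ℝ) * (k.val.map w).prod else 0 := by
    intro k hk
    have he := two_mul_sum_map_half (m := k.val) fun p hp =>
      ((hmem p).1 (Finset.mem_sym_iff.1 hk p hp)).2.2
    rw [prod_map_monomial, Polynomial.coeff_natCast_mul, Polynomial.coeff_monomial]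
    split_ifs <;> first | rfl | omega | simp
  rw [evenPartPoly, Finset.sum_pow, Polynomial.finsetSum_coeff, Finset.sum_congr rfl hcoeff,
    ← Finset.sum_filter, Finset.sum_div]
  refine Finset.sum_bij
    (fun μ hμ => (⟨μ.parts, (Finset.mem_filter.1 hμ).2.2⟩ : Sym ℕ l)) ?_ ?_ ?_ ?_
  · intro μ hμ
    have h := (Finset.mem_filter.1 hμ).2
    refine Finset.mem_filter.2 ⟨Finset.mem_sym_iff.2 fun p hp =>
      (hmem p).2 ⟨μ.parts_pos hp, ?_, h.1 p hp⟩, μ.parts_sum⟩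
    exact (Multiset.le_sum_of_mem hp).trans_eq μ.parts_sum
  · intro μ _ ν _ h
    exact Nat.Partition.ext (congrArg Subtype.val h)
  · intro k hk
    rw [Finset.mem_filter, Finset.mem_sym_iff] at hk
    refine ⟨⟨k.val, fun hp => ((hmem _).1 (hk.1 _ hp)).1, hk.2⟩, ?_, rfl⟩
    exact Finset.mem_filter.2 ⟨Finset.mem_univ _, fun p hp => ((hmem p).1 (hk.1 p hp)).2.2, k.2⟩
  · intro μ hμ
    have h := prod_factorial_count_mul_countPerms μ.parts
    rw [(Finset.mem_filter.1 hμ).2.2] at h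
    have h' : (∏ i ∈ μ.parts.toFinset, ((μ.parts.count i)! : ℝ)) *
        (μ.parts.countPerms : ℝ) = l ! := by
      exact_mod_cast h
    have hne : (∏ i ∈ μ.parts.toFinset, ((μ.parts.count i)! : ℝ)) ≠ 0 :=
      Finset.prod_ne_zero_iff.2 fun i _ => by positivity
    have hl : (l ! : ℝ) ≠ 0 := by positivity
    rw [div_eq_div_iff hne hl, ← h']
    ring

/-- Up to a factor `2 (9/2) ^ j`, this bounds the contribution of the partitions of length `j + 1`. -/
noncomputable def lengthWeight (g j : ℕ) : ℝ :=
  2 ^ (2 * g - 3) * (2 * g - 2)! / (4 * g - 3 - j)! / (j + 1)! * oddDouble (g - j)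

theorem lengthWeight_nonneg (g j : ℕ) : 0 ≤ lengthWeight g j :=
  mul_nonneg (by positivity) (oddDouble_nonneg _)

theorem lengthWeight_zero {g : ℕ} (hg : 1 < g) : lengthWeight g 0 = 1 / 2 := by
  obtain ⟨k, rfl⟩ := Nat.exists_eq_add_of_le' hg
  have h1 := Nat.factorial_eq_mul_doubleFactorial (4 * k + 4)
  have h2 := Nat.doubleFactorial_two_mul (2 * k + 2)
  rw [show 2 * (2 * k + 2) = 4 * k + 4 by ring] at h2
  have e1 : 2 * (k + 2) - 3 = 2 * k + 1 := by omega
  have e2 : 2 * (k + 2) - 2 = 2 * k + 2 := by omega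
  have e3 : 4 * (k + 2) - 3 - 0 = 4 * k + 4 + 1 := by omega
  have e4 : oddDouble (k + 2 - 0) = ((4 * k + 4 + 1)‼ : ℕ) := rfl
  rw [lengthWeight, e1, e2, e3, e4, h1, h2]
  have h3 : ((4 * k + 4 + 1)‼ : ℝ) ≠ 0 := by
    exact_mod_cast (Nat.doubleFactorial_pos _).ne'
  push_cast
  field_simp
  simp
  ring

theorem lengthWeight_succ (m j : ℕ) :
    lengthWeight (j + m + 2) (j + 1) * ((4 * m + 5) * (4 * m + 3) * (j + 2)) =
      lengthWeight (j + m + 2) j * (4 * m + 5 + 3 * j) := by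
  have e1 : 4 * (j + m + 2) - 3 - j = (4 * m + 3 * j + 4) + 1 := by omega
  have e2 : 4 * (j + m + 2) - 3 - (j + 1) = 4 * m + 3 * j + 4 := by omega
  have e3 : j + m + 2 - (j + 1) = m + 1 := by omega
  have e4 : j + m + 2 - j = m + 2 := by omega
  rw [lengthWeight, lengthWeight, e1, e2, e3, e4, oddDouble_add_two,
    Nat.factorial_succ (j + 1), Nat.factorial_succ (4 * m + 3 * j + 4)]
  push_cast
  field_simp
  ring

theorem lengthWeight_of_le {g j : ℕ} (h : g ≤ j) : lengthWeight g j = 0 := by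
  rw [lengthWeight, Nat.sub_eq_zero_of_le h]
  simp [oddDouble]

theorem lengthWeight_one_le {g : ℕ} (hg : 1 < g) : lengthWeight g 1 ≤ 1 / (6 * g) := by
  obtain ⟨m, rfl⟩ := Nat.exists_eq_add_of_le' hg
  have h := lengthWeight_succ m 0
  rw [zero_add, lengthWeight_zero hg] at h
  have h0 := lengthWeight_nonneg (m + 2) 1
  rw [le_div_iff₀ (by positivity)]
  have hm : (0 : ℝ) ≤ m := m.cast_nonneg
  have h' : lengthWeight (m + 2) 1 * (4 * m + 3) = 1 / 4 := by
    have : (4 * (m : ℝ) + 5) ≠ 0 := by positivity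
    apply mul_left_cancel₀ this
    push_cast at h
    linarith
  push_cast
  nlinarith [mul_nonneg h0 hm]

theorem lengthWeight_succ_le (g j : ℕ) : lengthWeight g (j + 1) ≤ lengthWeight g j / 5 := by
  rcases lt_or_ge (j + 1) g with h | h
  · obtain ⟨m, rfl⟩ := Nat.exists_eq_add_of_le h
    have h := lengthWeight_succ m j
    rw [show j + 1 + 1 + m = j + m + 2 by ring]
    have h0 := lengthWeight_nonneg (j + m + 2) j
    have hm : (0 : ℝ) ≤ m := m.cast_nonneg
    have hj : (0 : ℝ) ≤ j := j.cast_nonneg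
    have hpos : 0 < (4 * (m : ℝ) + 5) * (4 * m + 3) * (j + 2) := by positivity
    refine le_of_mul_le_mul_right ?_ hpos
    rw [h, div_mul_eq_mul_div, le_div_iff₀ (by norm_num), mul_assoc]
    refine mul_le_mul_of_nonneg_left ?_ h0
    nlinarith [mul_nonneg hm hj, mul_nonneg (mul_nonneg hm hj) hm, mul_nonneg hm hm]
  · rw [lengthWeight_of_le h]
    exact div_nonneg (lengthWeight_nonneg _ _) (by norm_num)

theorem lengthWeight_le {g : ℕ} (hg : 1 < g) (j : ℕ) :
    lengthWeight g (j + 1) ≤ 1 / (6 * g) * (1 / 5) ^ j := by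
  induction j with
  | zero => simpa using lengthWeight_one_le hg
  | succ j ih =>
    refine (lengthWeight_succ_le g (j + 1)).trans ?_
    rw [pow_succ]
    linarith

/-- The factor `(2p - 3)‼ 𝔷(p)` contributed by a part `p`. -/
noncomputable def partWeight (p : ℕ) : ℝ := ((2 * p - 3)‼ : ℕ) * zed (p : ℤ)

theorem partWeight_two_mul {m : ℕ} (hm : 1 ≤ m) :
    partWeight (2 * m) = oddDouble m * zed ((2 * m : ℕ) : ℤ) := by
  obtain ⟨k, rfl⟩ := Nat.exists_eq_add_of_le' hm
  rw [partWeight, oddDouble, show 2 * (2 * (k + 1)) - 3 = 4 * k + 1 by omega]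

theorem zed_two_mul_nonneg {m : ℕ} (hm : 1 ≤ m) : 0 ≤ zed ((2 * m : ℕ) : ℤ) := by
  have h1 := (zed_bounds (k := 2 * m) (by omega) (even_two_mul m)).1
  have h3 : (1 / 2 : ℝ) ^ (2 * m) ≤ (1 / 2) ^ 2 :=
    pow_le_pow_of_le_one (by norm_num) (by norm_num) (by omega)
  linarith

theorem coeff_evenPartPoly_partWeight_bounds (g m : ℕ) :
    0 ≤ (evenPartPoly partWeight g).coeff m ∧
      (evenPartPoly partWeight g).coeff m ≤ 2 * oddDouble m := by
  have h0 := oddDouble_nonneg m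
  rw [coeff_evenPartPoly]
  split_ifs with h
  · have hm := (Finset.mem_Icc.1 h).1
    rw [partWeight_two_mul hm, mul_comm 2 (oddDouble m)]
    exact ⟨mul_nonneg h0 (zed_two_mul_nonneg hm),
      mul_le_mul_of_nonneg_left (zed_bounds (by omega) (even_two_mul m)).2 h0⟩
  · exact ⟨le_rfl, by positivity⟩

theorem card_parts_bounds {g : ℕ} (hg : 1 < g) {μ : Nat.Partition (2 * g)}
    (h : ∀ p ∈ μ.parts, Even p) : 1 ≤ Multiset.card μ.parts ∧ Multiset.card μ.parts ≤ g := by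
  constructor
  · rw [Nat.one_le_iff_ne_zero, Ne, Multiset.card_eq_zero]
    intro h0
    have := μ.parts_sum
    simp [h0] at this
    omega
  · have := Multiset.card_nsmul_le_sum (s := μ.parts) (a := 2) fun p hp => by
      have := μ.parts_pos hp
      obtain ⟨a, rfl⟩ := h p hp
      omega
    rw [μ.parts_sum, smul_eq_mul] at this
    omega

theorem sum_even_partitions_eq {g : ℕ} (hg : 1 < g) :
    ∑ μ ∈ (Finset.univ : Finset (Nat.Partition (2 * g))).filter
            (fun μ => ∀ p ∈ μ.parts, Even p),
          (-1 : ℝ) ^ (Multiset.card μ.parts - 1) /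
              ((2 * (2 * g - 2) - Multiset.card μ.parts + 2)! *
                ∏ i ∈ μ.parts.toFinset, ((μ.parts.count i)! : ℝ)) *
            (μ.parts.map fun p => (((2 * p - 3)‼ : ℕ) : ℝ) * zed (p : ℤ)).prod =
    ∑ j ∈ range g, (-1 : ℝ) ^ j / (4 * g - 3 - j)! *
      ((evenPartPoly partWeight g ^ (j + 1)).coeff g / (j + 1)!) := by
  rw [← Finset.sum_fiberwise_of_maps_to (t := range g) (g := fun μ => Multiset.card μ.parts - 1)]
  · refine Finset.sum_congr rfl fun j hj => ?_
    rw [← sum_even_partitions_eq_coeff, Finset.mul_sum, Finset.filter_filter]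
    have hf : ∀ μ : Nat.Partition (2 * g),
        ((∀ p ∈ μ.parts, Even p) ∧ Multiset.card μ.parts - 1 = j) ↔
        ((∀ p ∈ μ.parts, Even p) ∧ Multiset.card μ.parts = j + 1) := fun μ =>
      and_congr_right fun h => by
        have := card_parts_bounds hg h
        omega
    rw [Finset.filter_congr fun μ _ => hf μ]
    refine Finset.sum_congr rfl fun μ hμ => ?_
    have hc := (Finset.mem_filter.1 hμ).2.2
    rw [Finset.mem_range] at hj
    rw [hc, show 2 * (2 * g - 2) - (j + 1) + 2 = 4 * g - 3 - j by omega, Nat.add_sub_cancel]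
    change _ / _ * (μ.parts.map partWeight).prod = _
    ring
  · intro μ hμ
    have := card_parts_bounds hg (Finset.mem_filter.1 hμ).2
    rw [Finset.mem_range]
    omega

theorem sum_lengthWeight_le {g : ℕ} (hg : 1 < g) (N : ℕ) :
    ∑ j ∈ range N, 2 * (9 / 2) ^ (j + 1) * lengthWeight g (j + 1) ≤ 15 / g := by
  have hg0 : (0 : ℝ) < g := by exact_mod_cast (by omega : 0 < g)
  calc _ ≤ ∑ j ∈ range N, 3 / 2 / g * (9 / 10 : ℝ) ^ j := by
        refine Finset.sum_le_sum fun j _ => ?_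
        calc _ ≤ 2 * (9 / 2) ^ (j + 1) * (1 / (6 * g) * (1 / 5 : ℝ) ^ j) := by
              gcongr
              exact lengthWeight_le hg j
          _ = _ := by
              rw [show (9 / 10 : ℝ) = 9 / 2 * (1 / 5) by norm_num, mul_pow, pow_succ]
              field_simp
              ring
    _ = 3 / 2 / g * ∑ j ∈ range N, (9 / 10 : ℝ) ^ j := by rw [Finset.mul_sum]
    _ ≤ 3 / 2 / g * 10 := by
        gcongr
        have h : (0 : ℝ) ≤ (9 / 10) ^ N := by positivity
        rw [geom_sum_eq (by norm_num), div_le_iff_of_neg (by norm_num)]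
        linarith
    _ = _ := by ring

theorem four_mul_half_pow_le {g : ℕ} (hg : 1 < g) : 4 * (1 / 2 : ℝ) ^ (2 * g) ≤ 1 / g := by
  have h : g < 2 ^ g := Nat.lt_two_pow_self
  have h4 : 4 ≤ 2 ^ g := by simpa using Nat.pow_le_pow_right (n := 2) (by norm_num) hg
  have h' : (4 * g : ℝ) ≤ 2 ^ (2 * g) := by
    rw [two_mul, pow_add]
    exact_mod_cast Nat.mul_le_mul h4 h.le
  have hg0 : (0 : ℝ) < g := by exact_mod_cast (by omega : 0 < g)
  rw [one_div_pow, mul_one_div, div_le_div_iff₀ (by positivity) hg0]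
  linarith

/-- Let `g > 1` and `n = 2g − 2`.  Then
`| 2^{n−1} n! Σ_{μ ∈ Y_{n+2}, μ even} (−1)^{ℓ(μ)−1} / ((2n−ℓ(μ)+2)! ∏ M_i(μ)!)
   · ∏_i (2μ_i−3)!! 𝔷(μ_i) − 1 | ≤ 2^{20}/g`,
which establishes the large-genus asymptotics of the Masur–Veech volume of the
principal stratum, since the quantity inside the absolute value equals
`2^{2g−4} ν₁(H₁(1^{2g−2})) − 1` by an identity of Eskin–Okounkov. -/
theorem principal_stratum_asymptotic (g : ℕ) (hg : 1 < g) :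
    |2 ^ (2 * g - 3) * ((2 * g - 2)! : ℝ) *
        (∑ μ ∈ (Finset.univ : Finset (Nat.Partition (2 * g))).filter
            (fun μ => ∀ p ∈ μ.parts, Even p),
          (-1 : ℝ) ^ (Multiset.card μ.parts - 1) /
              ((2 * (2 * g - 2) - Multiset.card μ.parts + 2)! *
                ∏ i ∈ μ.parts.toFinset, ((μ.parts.count i)! : ℝ)) *
            (μ.parts.map fun p => (((2 * p - 3)‼ : ℕ) : ℝ) * zed (p : ℤ)).prod)
      - 1| ≤ 2 ^ 20 / g := by
  have hg0 : (0 : ℝ) < g := by exact_mod_cast (by omega : 0 < g)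
  rw [sum_even_partitions_eq hg, Finset.mul_sum]
  obtain ⟨N, rfl⟩ : ∃ N, g = N + 1 := ⟨g - 1, by omega⟩
  rw [Finset.sum_range_succ']
  set g := N + 1
  have hrest : |∑ j ∈ range N, 2 ^ (2 * g - 3) * ((2 * g - 2)! : ℝ) *
      ((-1 : ℝ) ^ (j + 1) / (4 * g - 3 - (j + 1))! *
        ((evenPartPoly partWeight g ^ (j + 1 + 1)).coeff g / (j + 1 + 1)!))| ≤ 15 / g := by
    refine (Finset.abs_sum_le_sum_abs _ _).trans ((Finset.sum_le_sum fun j _ => ?_).trans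
      (sum_lengthWeight_le hg N))
    obtain ⟨h1, h2⟩ := coeff_pow_le (fun m => (coeff_evenPartPoly_partWeight_bounds g m).1)
      (fun m => (coeff_evenPartPoly_partWeight_bounds g m).2) (j + 1) g
    simp only [abs_mul, abs_div, abs_pow, abs_neg, abs_one, one_pow, Nat.abs_cast, abs_two,
      abs_of_nonneg h1]
    calc _ ≤ 2 ^ (2 * g - 3) * ((2 * g - 2)! : ℝ) * (1 / (4 * g - 3 - (j + 1))! *
          (2 * (9 / 2) ^ (j + 1) * oddDouble (g - (j + 1)) / (j + 1 + 1)!)) := by gcongr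
      _ = _ := by
        rw [lengthWeight]
        ring
  have hmain : 2 ^ (2 * g - 3) * ((2 * g - 2)! : ℝ) *
      ((-1 : ℝ) ^ 0 / (4 * g - 3 - 0)! *
        ((evenPartPoly partWeight g ^ (0 + 1)).coeff g / (0 + 1)!)) =
      zed ((2 * g : ℕ) : ℤ) / 2 := by
    have h := lengthWeight_zero hg
    rw [zero_add, pow_one, coeff_evenPartPoly, if_pos (Finset.mem_Icc.2 ⟨hg.le, le_rfl⟩),
      partWeight_two_mul hg.le, div_eq_mul_one_div (zed _), ← h, lengthWeight]
    simp only [Nat.sub_zero, zero_add, pow_zero]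
    ring
  rw [hmain]
  obtain ⟨hz1, hz2⟩ := zed_bounds (k := 2 * g) (by omega) (even_two_mul g)
  have hz3 := four_mul_half_pow_le hg
  rw [abs_le] at hrest ⊢
  have e1 : (2 ^ 20 / g : ℝ) = 2 ^ 20 * (1 / g) := by ring
  have e2 : (15 / g : ℝ) = 15 * (1 / g) := by ring
  have hp : (0 : ℝ) < 1 / g := by positivity
  rw [e2] at hrest
  rw [e1]
  constructor <;> linarith [hrest.1, hrest.2]
end

section
/- Let a ≥ 1 and b ≥ 0 be integers; let λ^(1), λ^(2), …, λ^(a) be partitions each of length at least two; and let D₁, D₂, …, D_b ≥ 2 be integers. Set ℓ_i = ℓ(λ^(i)) for 1 ≤ i ≤ a, L = ℓ₁ + … + ℓ_a, |λ| = |λ^(1)| + … + |λ^(a)|, and B = D₁ + … + D_b. Then |⟨p_{λ^(1)} | p_{λ^(2)} | ⋯ | p_{λ^(a)} | p_{D₁} | p_{D₂} | ⋯ | p_{D_b}⟩| ≤ 2^{89L+5} · (|λ| + a + B − L)!. -/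
open Nat Finset

attribute [local instance] Classical.propDecidable

/-- `P` is a (reduced) set partition of the finite set `S`: a collection of nonempty
disjoint subsets of `S` whose union is `S` (each element of `S` lies in exactly one
component). -/
def IsSetPartitionOn {ι : Type*} [DecidableEq ι] (S : Finset ι) (P : Finset (Finset ι)) :
    Prop :=
  (∀ s ∈ P, s ⊆ S ∧ s ≠ ∅) ∧ ∀ x ∈ S, ∃! s, s ∈ P ∧ x ∈ s

/-- `P` refines `Q`: every component of `P` is contained in a component of `Q`. -/
def Refines {ι : Type*} (P Q : Finset (Finset ι)) : Prop :=
  ∀ s ∈ P, ∃ t ∈ Q, s ⊆ t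

/-- Two set partitions `α`, `β` of a finite type `ι` (with `n = |ι|` elements) are
complementary if `ℓ(α) + ℓ(β) = n + 1` and the minimal set partition refined by both
`α` and `β` is the maximal (one-component) set partition; equivalently, the only common
coarsening of `α` and `β` is the one-component partition. -/
def IsComplementary {ι : Type*} [Fintype ι] [DecidableEq ι]
    (α β : Finset (Finset ι)) : Prop :=
  α.card + β.card = Fintype.card ι + 1 ∧
    ∀ γ : Finset (Finset ι), IsSetPartitionOn Finset.univ γ →
      Refines α γ → Refines β γ → γ = {Finset.univ}

/-- The quantity `E(m)` of Eskin–Okounkov, for a weight function `v` on a finite ground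
set `S`:
`E = Σ_{P partition of S, ℓ(P) ≥ 2} (−1)^{ℓ(P)−1} (ℓ(P)−2)!
      Σ_{d : P → ℕ, Σ d = ℓ(P)−2} ∏_{s ∈ P} (1/d_s!) · |v_s|! · 𝔷(|v_s| − |s| − d_s + 1)`,
where `|v_s| = Σ_{x ∈ s} v(x)` and `|s|` is the cardinality of the component `s`. -/
noncomputable def Emap {ι : Type*} [Fintype ι] [DecidableEq ι]
    (S : Finset ι) (v : ι → ℕ) : ℝ :=
  ∑ P ∈ Finset.univ.filter
      (fun P : Finset (Finset ι) => IsSetPartitionOn S P ∧ 2 ≤ P.card),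
    (-1 : ℝ) ^ (P.card - 1) * ((P.card - 2)! : ℝ) *
      ∑ d ∈ Finset.finsuppAntidiag P (P.card - 2),
        ∏ s ∈ P,
          (1 / ((d s)! : ℝ) * ((∑ x ∈ s, v x)! : ℝ) *
            zed ((∑ x ∈ s, v x : ℤ) - s.card - d s + 1))

/-- The single-bracket inner product `⟨m⟩ = |m|! · 𝔷(|m| − n + 2) + E(m)`, where the
entries of the tuple `m` are the values of `v` on the `n`-element ground set `S`. -/
noncomputable def innerSingle {ι : Type*} [Fintype ι] [DecidableEq ι]
    (S : Finset ι) (v : ι → ℕ) : ℝ :=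
  ((∑ x ∈ S, v x)! : ℝ) * zed ((∑ x ∈ S, v x : ℤ) - S.card + 2) + Emap S v

/-- The multi-fold inner product `⟨p_{λ^(1)} | ⋯ | p_{λ^(n)}⟩`.  The data of the
partitions `λ^(1), …, λ^(n)` is encoded by a ground set `ι` of size `L` (positions of
all parts), the value map `v : ι → ℕ` recording the parts, and the set partition `ρ`
of `ι` whose components group the positions belonging to the same `λ^(j)`.  Then
`⟨p_{λ^(1)} | ⋯ | p_{λ^(n)}⟩ = Σ_{α ∈ 𝒞(ρ)} ∏_{s ∈ α} ⟨λ_s⟩`, the sum running over set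
partitions `α` of `ι` complementary to `ρ`, where `λ_s` is the tuple of parts at the
positions in the component `s`. -/
noncomputable def innerMulti {ι : Type*} [Fintype ι] [DecidableEq ι]
    (ρ : Finset (Finset ι)) (v : ι → ℕ) : ℝ :=
  ∑ α ∈ Finset.univ.filter
      (fun α : Finset (Finset ι) =>
        IsSetPartitionOn Finset.univ α ∧ IsComplementary ρ α),
    ∏ s ∈ α, innerSingle s v

theorem zetaSeries_nonneg (k : ℤ) : 0 ≤ zetaSeries k :=
  tsum_nonneg fun j => by positivity

theorem zetaSeries_le_of_le {n : ℕ} (hn : 2 ≤ n) {k : ℤ} (hk : (n : ℤ) ≤ k) {c : ℝ}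
    (hc : HasSum (fun j : ℕ => 1 / (j : ℝ) ^ n) c) : zetaSeries k ≤ c := by
  have hs : HasSum (fun j : ℕ => 1 / ((j + 1 : ℕ) : ℝ) ^ n) c := by
    have := (hasSum_nat_add_iff' 1).mpr hc
    simpa [show n ≠ 0 by omega] using this
  have hle : ∀ j : ℕ, ((j : ℝ) + 1) ^ (-k) ≤ 1 / ((j + 1 : ℕ) : ℝ) ^ n := fun j => by
    have h1 : (1 : ℝ) ≤ (j : ℝ) + 1 := by simp
    calc ((j : ℝ) + 1) ^ (-k) ≤ ((j : ℝ) + 1) ^ (-(n : ℤ)) :=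
          zpow_le_zpow_right₀ h1 (by omega)
      _ = _ := by rw [zpow_neg, zpow_natCast, one_div]; push_cast; rfl
  have hsum : Summable fun j : ℕ => ((j : ℝ) + 1) ^ (-k) :=
    Summable.of_nonneg_of_le (fun j => by positivity) hle hs.summable
  rw [← hs.tsum_eq]
  exact hsum.tsum_le_tsum hle hs.summable

theorem abs_zed_le (k : ℤ) : |zed k| ≤ 11 / 5 := by
  unfold zed
  split_ifs with h0 h2
  · norm_num
  · have hz := zetaSeries_nonneg k
    have hp : (0 : ℝ) < 2 ^ (2 - k) := by positivity
    have hp1 : (2 : ℝ) ^ (2 - k) ≤ 1 := zpow_le_one_of_nonpos₀ (by norm_num) (by omega)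
    have hpi := Real.pi_lt_d2
    have hpi0 := Real.pi_pos
    have hpi2 : Real.pi ^ 2 ≤ 9.9225 := by nlinarith
    rw [abs_of_nonneg (mul_nonneg (by linarith) hz)]
    by_cases hk : k = 2
    · subst hk
      have := zetaSeries_le_of_le (n := 2) le_rfl (k := 2) (by norm_num) hasSum_zeta_two
      norm_num
      linarith
    · have h4 : (4 : ℤ) ≤ k := by
        obtain ⟨h2, m, rfl⟩ := h2
        omega
      have := zetaSeries_le_of_le (n := 4) (by norm_num) (k := k) (by exact_mod_cast h4)
        hasSum_zeta_four
      have : Real.pi ^ 4 ≤ 98.5 := by nlinarith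
      nlinarith
  · norm_num

theorem sum_inv_factorial_le (n : ℕ) : ∑ j ∈ range n, 1 / (j ! : ℝ) ≤ 30 / 11 := by
  have h := Real.sum_le_exp_of_nonneg (x := 1) (by norm_num) n
  simp only [one_pow] at h
  linarith [Real.exp_one_lt_d9]

theorem sum_finsuppAntidiag_prod_inv_factorial_le {κ : Type*} [DecidableEq κ] (P : Finset κ)
    (n : ℕ) : ∑ d ∈ finsuppAntidiag P n, ∏ s ∈ P, 1 / ((d s)! : ℝ) ≤ (30 / 11) ^ P.card := by
  calc ∑ d ∈ finsuppAntidiag P n, ∏ s ∈ P, 1 / ((d s)! : ℝ)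
      ≤ ∑ p ∈ P.pi fun _ => range (n + 1), ∏ s ∈ P.attach, 1 / ((p s.1 s.2)! : ℝ) := by
        refine le_of_eq_of_le ?_ (sum_le_sum_of_subset_of_nonneg
          (s := (finsuppAntidiag P n).image fun d s _ => d s) ?_ fun _ _ _ => by positivity)
        · rw [sum_image]
          · exact sum_congr rfl fun d _ => (prod_attach P fun s => 1 / ((d s)! : ℝ)).symm
          · intro d hd d' hd' h
            rw [mem_coe, mem_finsuppAntidiag] at hd hd'
            ext s
            by_cases hs : s ∈ P
            · exact congrFun (congrFun h s) hs
            · rw [Finsupp.notMem_support_iff.mp fun h => hs (hd.2 h),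
                Finsupp.notMem_support_iff.mp fun h => hs (hd'.2 h)]
        · intro p hp
          obtain ⟨d, hd, rfl⟩ := mem_image.mp hp
          rw [mem_finsuppAntidiag] at hd
          rw [mem_pi]
          intro s hs
          rw [mem_range, Nat.lt_succ_iff, ← hd.1]
          exact single_le_sum (f := fun s => d s) (fun _ _ => Nat.zero_le _) hs
    _ = ∏ s ∈ P, ∑ j ∈ range (n + 1), 1 / (j ! : ℝ) := (prod_sum P _ fun _ j => 1 / (j ! : ℝ)).symm
    _ ≤ ∏ s ∈ P, (30 / 11 : ℝ) :=
        prod_le_prod (fun _ _ => sum_nonneg fun _ _ => by positivity)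
          fun _ _ => sum_inv_factorial_le _
    _ = _ := prod_const _

/-- The majorant `Σ_P (ℓ(P) − 1)! 6^{ℓ(P)} ∏_{s ∈ P} |v_s|!` of `innerSingle S v`, the sum running
over all set partitions `P` of `S`. -/
noncomputable def partitionMajorant {ι : Type*} [Fintype ι] [DecidableEq ι] (S : Finset ι)
    (v : ι → ℕ) : ℝ :=
  ∑ P ∈ univ.filter (IsSetPartitionOn S),
    ((P.card - 1)! : ℝ) * 6 ^ P.card * ∏ s ∈ P, ((∑ x ∈ s, v x)! : ℝ)

theorem abs_Emap_le {ι : Type*} [Fintype ι] [DecidableEq ι] (S : Finset ι) (v : ι → ℕ) :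
    |Emap S v| ≤ ∑ P ∈ univ.filter fun P => IsSetPartitionOn S P ∧ 2 ≤ P.card,
      ((P.card - 1)! : ℝ) * 6 ^ P.card * ∏ s ∈ P, ((∑ x ∈ s, v x)! : ℝ) := by
  refine (abs_sum_le_sum_abs _ _).trans (sum_le_sum fun P _ => ?_)
  rw [abs_mul, abs_mul, abs_pow, abs_neg, abs_one, one_pow, one_mul, Nat.abs_cast, mul_assoc]
  refine mul_le_mul (by exact_mod_cast Nat.factorial_le (by omega)) ?_ (abs_nonneg _)
    (Nat.cast_nonneg _)
  set W : ℝ := ∏ s ∈ P, ((∑ x ∈ s, v x)! : ℝ)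
  have hW : 0 ≤ W := prod_nonneg fun _ _ => by positivity
  calc |∑ d ∈ finsuppAntidiag P (P.card - 2), ∏ s ∈ P, (1 / ((d s)! : ℝ) *
          ((∑ x ∈ s, v x)! : ℝ) * zed ((∑ x ∈ s, v x : ℤ) - s.card - d s + 1))|
      ≤ ∑ d ∈ finsuppAntidiag P (P.card - 2),
          (∏ s ∈ P, 1 / ((d s)! : ℝ)) * W * (11 / 5) ^ P.card := by
        refine (abs_sum_le_sum_abs _ _).trans (sum_le_sum fun d _ => ?_)
        rw [prod_mul_distrib, prod_mul_distrib, abs_mul, abs_of_nonneg (by positivity), abs_prod]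
        gcongr
        exact (prod_le_prod (fun _ _ => abs_nonneg _) fun _ _ => abs_zed_le _).trans_eq
          (prod_const _)
    _ ≤ (30 / 11) ^ P.card * W * (11 / 5) ^ P.card := by
        rw [← sum_mul, ← sum_mul]
        gcongr
        exact sum_finsuppAntidiag_prod_inv_factorial_le _ _
    _ = 6 ^ P.card * W := by
        rw [mul_right_comm, ← mul_pow]; norm_num

theorem isSetPartitionOn_singleton {ι : Type*} [DecidableEq ι] {S : Finset ι}
    (hS : S.Nonempty) : IsSetPartitionOn S {S} := by
  refine ⟨fun s hs => ?_, fun x hx => ⟨S, ⟨mem_singleton_self S, hx⟩, fun t ht => ?_⟩⟩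
  · rw [mem_singleton] at hs
    exact ⟨hs.subset, hs ▸ hS.ne_empty⟩
  · exact mem_singleton.mp ht.1

theorem abs_innerSingle_le_partitionMajorant {ι : Type*} [Fintype ι] [DecidableEq ι]
    {S : Finset ι} (hS : S.Nonempty) (v : ι → ℕ) :
    |innerSingle S v| ≤ partitionMajorant S v := by
  refine (abs_add_le _ _).trans ?_
  have hsub : insert {S} (univ.filter fun P => IsSetPartitionOn S P ∧ 2 ≤ P.card) ⊆
      univ.filter (IsSetPartitionOn S) := by
    intro P hP
    rw [mem_filter]
    refine ⟨mem_univ _, ?_⟩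
    rcases mem_insert.mp hP with rfl | hP
    · exact isSetPartitionOn_singleton hS
    · exact (mem_filter.mp hP).2.1
  refine le_trans ?_ (sum_le_sum_of_subset_of_nonneg hsub fun _ _ _ =>
    mul_nonneg (by positivity) (prod_nonneg fun _ _ => by positivity))
  rw [sum_insert (by simp)]
  refine add_le_add ?_ (abs_Emap_le S v)
  rw [abs_mul, Nat.abs_cast, card_singleton, prod_singleton, Nat.sub_self, Nat.factorial_zero]
  have := abs_zed_le ((∑ x ∈ S, v x : ℤ) - S.card + 2)
  have h0 : (0 : ℝ) ≤ ((∑ x ∈ S, v x)! : ℝ) := Nat.cast_nonneg _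
  push_cast
  nlinarith
theorem sum_le_sum_of_subset_image {κ τ : Type*} [DecidableEq τ] {T : Finset τ} {A : Finset κ}
    {g : κ → τ} {F : τ → ℝ} (hT : T ⊆ A.image g) (hF : ∀ t, 0 ≤ F t) :
    ∑ t ∈ T, F t ≤ ∑ k ∈ A, F (g k) :=
  (sum_le_sum_of_subset_of_nonneg hT fun _ _ _ => hF _).trans
    (sum_image_le_of_nonneg fun _ _ => hF _)

namespace IsSetPartitionOn

variable {ι : Type*} [DecidableEq ι] {S : Finset ι} {P : Finset (Finset ι)}

theorem eq_of_mem (hP : IsSetPartitionOn S P) {s t : Finset ι} (hs : s ∈ P) (ht : t ∈ P) {x : ι}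
    (hxs : x ∈ s) (hxt : x ∈ t) : s = t :=
  (hP.2 x ((hP.1 s hs).1 hxs)).unique ⟨hs, hxs⟩ ⟨ht, hxt⟩

theorem pairwiseDisjoint (hP : IsSetPartitionOn S P) :
    (P : Set (Finset ι)).PairwiseDisjoint id := fun _ hs _ ht hst =>
  disjoint_left.mpr fun _ hxs hxt => hst (hP.eq_of_mem hs ht hxs hxt)

theorem biUnion_eq (hP : IsSetPartitionOn S P) : P.biUnion id = S := by
  ext x
  rw [mem_biUnion]
  constructor
  · rintro ⟨s, hs, hx⟩
    exact (hP.1 s hs).1 hx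
  · intro hx
    obtain ⟨s, hs, -⟩ := hP.2 x hx
    exact ⟨s, hs⟩

theorem sum_sum {M : Type*} [AddCommMonoid M] (hP : IsSetPartitionOn S P) (f : ι → M) :
    ∑ s ∈ P, ∑ x ∈ s, f x = ∑ x ∈ S, f x := by
  rw [← hP.biUnion_eq, sum_biUnion hP.pairwiseDisjoint]
  rfl

theorem prod_prod {M : Type*} [CommMonoid M] (hP : IsSetPartitionOn S P) (f : ι → M) :
    ∏ s ∈ P, ∏ x ∈ s, f x = ∏ x ∈ S, f x := by
  rw [← hP.biUnion_eq, prod_biUnion hP.pairwiseDisjoint]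
  rfl

theorem nonempty (hP : IsSetPartitionOn S P) (hS : S.Nonempty) : P.Nonempty := by
  obtain ⟨x, hx⟩ := hS
  obtain ⟨s, hs, -⟩ := hP.2 x hx
  exact ⟨s, hs.1⟩

theorem one_le_sum (hP : IsSetPartitionOn S P) {v : ι → ℕ} (hv : ∀ x, 1 ≤ v x) (s : Finset ι)
    (hs : s ∈ P) : 1 ≤ ∑ x ∈ s, v x := by
  obtain ⟨x, hx⟩ := nonempty_iff_ne_empty.mpr (hP.1 s hs).2
  exact (hv x).trans (single_le_sum (f := v) (fun _ _ => Nat.zero_le _) hx)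

end IsSetPartitionOn

/-- Adjoin a new element `x` to a set partition `P`, as a singleton component or inside an existing
component. -/
def adjoinToPartition {ι : Type*} [DecidableEq ι] (x : ι) (P : Finset (Finset ι)) :
    Option (Finset ι) → Finset (Finset ι)
  | none => insert {x} P
  | some s => insert (insert x s) (P.erase s)

theorem IsSetPartitionOn.exists_adjoin {ι : Type*} [DecidableEq ι] {S : Finset ι} {x : ι}
    (hx : x ∉ S) {Q : Finset (Finset ι)} (hQ : IsSetPartitionOn (insert x S) Q) :
    ∃ P, IsSetPartitionOn S P ∧ ∃ o ∈ insertNone P, adjoinToPartition x P o = Q := by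
  obtain ⟨t, ⟨htQ, hxt⟩, -⟩ := hQ.2 x (mem_insert_self x S)
  have hsub : ∀ u ∈ Q.erase t, u ⊆ S ∧ u ≠ ∅ := fun u hu => by
    have hu' := mem_erase.mp hu
    refine ⟨fun y hy => (mem_insert.mp ((hQ.1 u hu'.2).1 hy)).resolve_left ?_, (hQ.1 u hu'.2).2⟩
    rintro rfl
    exact hu'.1 (hQ.eq_of_mem hu'.2 htQ hy hxt)
  by_cases htx : t = {x}
  · subst htx
    refine ⟨Q.erase {x}, ⟨hsub, fun y hy => ?_⟩, none, none_mem_insertNone, insert_erase htQ⟩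
    obtain ⟨u, ⟨huQ, hyu⟩, hu⟩ := hQ.2 y (mem_insert_of_mem hy)
    refine ⟨u, ⟨mem_erase.mpr ⟨?_, huQ⟩, hyu⟩, fun w hw => hu w ⟨mem_of_mem_erase hw.1, hw.2⟩⟩
    rintro rfl
    exact hx (mem_singleton.mp hyu ▸ hy)
  · have hne : t.erase x ≠ ∅ := fun h => htx (by rw [← insert_erase hxt, h]; rfl)
    have hnot : t.erase x ∉ Q.erase t := fun h => by
      obtain ⟨y, hy⟩ := nonempty_iff_ne_empty.mpr hne
      exact (mem_erase.mp h).1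
        (hQ.eq_of_mem (mem_of_mem_erase h) htQ hy (mem_of_mem_erase hy))
    refine ⟨insert (t.erase x) (Q.erase t), ⟨fun u hu => ?_, fun y hy => ?_⟩,
      some (t.erase x), some_mem_insertNone.mpr (mem_insert_self _ _), ?_⟩
    · rcases mem_insert.mp hu with rfl | hu
      · exact ⟨fun y hy => (mem_insert.mp ((hQ.1 t htQ).1 (mem_of_mem_erase hy))).resolve_left
          (ne_of_mem_erase hy), hne⟩
      · exact hsub u hu
    · have hyx : y ≠ x := by rintro rfl; exact hx hy
      obtain ⟨u, ⟨huQ, hyu⟩, hu⟩ := hQ.2 y (mem_insert_of_mem hy)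
      by_cases hut : u = t
      · subst hut
        refine ⟨u.erase x, ⟨mem_insert_self _ _, mem_erase.mpr ⟨hyx, hyu⟩⟩, fun w hw => ?_⟩
        rcases mem_insert.mp hw.1 with h | h
        · exact h
        · exact absurd (hu w ⟨mem_of_mem_erase h, hw.2⟩) (mem_erase.mp h).1
      · refine ⟨u, ⟨mem_insert_of_mem (mem_erase.mpr ⟨hut, huQ⟩), hyu⟩, fun w hw => ?_⟩
        rcases mem_insert.mp hw.1 with h | h
        · exact absurd (hu t ⟨htQ, mem_of_mem_erase (h ▸ hw.2)⟩).symm hut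
        · exact hu w ⟨mem_of_mem_erase h, hw.2⟩
    · rw [adjoinToPartition, erase_insert hnot, insert_erase hxt, insert_erase htQ]

theorem ascFactorial_mul_ascFactorial_le {x X k n : ℕ} (hx : x ≤ X) (hk : k ≤ n) :
    (x + 1).ascFactorial n * (X + 1).ascFactorial k ≤
      (x + 1).ascFactorial k * (X + 1).ascFactorial n := by
  induction n, hk using Nat.le_induction with
  | base => rfl
  | succ n _ ih =>
    rw [Nat.ascFactorial_succ, Nat.ascFactorial_succ]
    calc (x + 1 + n) * (x + 1).ascFactorial n * (X + 1).ascFactorial k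
        = (x + 1 + n) * ((x + 1).ascFactorial n * (X + 1).ascFactorial k) := by ring
      _ ≤ (X + 1 + n) * ((x + 1).ascFactorial k * (X + 1).ascFactorial n) := by gcongr
      _ = _ := by ring

theorem cast_succ_ascFactorial_one (x : ℕ) : (((x + 1).ascFactorial 1 : ℕ) : ℝ) = x + 1 := by
  rw [Nat.ascFactorial_succ, Nat.ascFactorial_zero]
  push_cast
  ring

theorem cast_succ_ascFactorial_two (x : ℕ) :
    (((x + 1).ascFactorial 2 : ℕ) : ℝ) = (x + 1) * (x + 2) := by
  rw [Nat.ascFactorial_succ, Nat.ascFactorial_succ, Nat.ascFactorial_zero]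
  push_cast
  ring

theorem ascFactorial_le_mul_div {x X k n : ℕ} (hx : x ≤ X) (hk : k ≤ n) :
    ((x + 1).ascFactorial n : ℝ) ≤
      (x + 1).ascFactorial k * ((X + 1).ascFactorial n / (X + 1).ascFactorial k) := by
  rw [← mul_div_assoc, le_div_iff₀ (by exact_mod_cast Nat.ascFactorial_pos X k)]
  exact_mod_cast ascFactorial_mul_ascFactorial_le hx hk

theorem sum_sq_le_of_one_le {κ : Type*} {E : Finset κ} {z : κ → ℝ}
    (hz : ∀ e ∈ E, 1 ≤ z e) :
    ∑ e ∈ E, z e ^ 2 ≤ (∑ e ∈ E, z e) * (∑ e ∈ E, z e - E.card + 1) := by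
  rw [sum_mul]
  refine sum_le_sum fun e he => ?_
  have h1 : ∑ f ∈ E.erase e, (z f - 1) ≥ 0 :=
    sum_nonneg fun f hf => sub_nonneg.mpr (hz f (mem_of_mem_erase hf))
  have h2 := add_sum_erase E (fun f => z f - 1) he
  have h3 : ∑ f ∈ E, (z f - 1) = ∑ f ∈ E, z f - E.card := by
    rw [sum_sub_distrib, sum_const, nsmul_eq_mul, mul_one]
  have := hz e he
  rw [sq]
  gcongr
  linarith

theorem card_le_sum_of_one_le {κ : Type*} {E : Finset κ} {z : κ → ℕ} (hz : ∀ e ∈ E, 1 ≤ z e) :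
    E.card ≤ ∑ e ∈ E, z e := by
  simpa using card_nsmul_le_sum E z 1 hz

/-- The factor by which `partitionMajorant` may grow when an element of weight `n ≥ 1` is adjoined
to a set of total weight `M`. -/
theorem sum_ascFactorial_add_le {κ : Type*} {E : Finset κ} {z : κ → ℕ}
    (hz : ∀ e ∈ E, 1 ≤ z e) {M : ℕ} (hM : ∑ e ∈ E, z e = M) {n : ℕ} (hn : 1 ≤ n) :
    ∑ e ∈ E, ((z e + 1).ascFactorial n : ℝ) + 6 * E.card * n ! ≤ 8 * (M + 1).ascFactorial n := by
  have hle : ∀ e ∈ E, z e ≤ M := fun e he =>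
    hM ▸ single_le_sum (f := z) (fun _ _ => Nat.zero_le _) he
  have hcard : (E.card : ℝ) ≤ M := by exact_mod_cast hM ▸ card_le_sum_of_one_le hz
  have hsum : ∑ e ∈ E, (z e : ℝ) = M := by exact_mod_cast hM
  set R : ℝ := (M + 1).ascFactorial n / (M + 1).ascFactorial 1 with hR
  have hR0 : 0 ≤ R := by positivity
  have h0 : (n ! : ℝ) ≤ R := by
    have := ascFactorial_le_mul_div (Nat.zero_le M) hn
    rw [zero_add, Nat.one_ascFactorial, Nat.one_ascFactorial, Nat.factorial_one, Nat.cast_one,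
      one_mul] at this
    exact this
  have hA : ((M + 1).ascFactorial n : ℝ) = (M + 1) * R := by
    rw [hR, cast_succ_ascFactorial_one]; field_simp
  calc ∑ e ∈ E, ((z e + 1).ascFactorial n : ℝ) + 6 * E.card * n !
      ≤ ∑ e ∈ E, ((z e : ℝ) + 1) * R + 6 * E.card * R := by
        refine add_le_add (sum_le_sum fun e he => ?_)
          (mul_le_mul_of_nonneg_left h0 (mul_nonneg (by norm_num) (Nat.cast_nonneg _)))
        rw [← cast_succ_ascFactorial_one]
        exact ascFactorial_le_mul_div (hle e he) hn
    _ = (M + E.card + 6 * E.card) * R := by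
        rw [← sum_mul, sum_add_distrib, hsum, sum_const, nsmul_eq_mul]; ring
    _ ≤ 8 * ((M + 1) * R) := by rw [← mul_assoc]; gcongr; linarith
    _ = _ := by rw [hA]

theorem sum_ascFactorial_add_le_of_two_le {κ : Type*} {E : Finset κ} (hE : E.Nonempty)
    {z : κ → ℕ} (hz : ∀ e ∈ E, 1 ≤ z e) {M : ℕ} (hM : ∑ e ∈ E, z e = M) {n : ℕ} (hn : 2 ≤ n) :
    ∑ e ∈ E, ((z e + 1).ascFactorial n : ℝ) + 6 * E.card * n ! ≤
      (1 + 54 / ((M + 1) * (M + 2))) * (M + 1).ascFactorial n := by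
  have hle : ∀ e ∈ E, z e ≤ M := fun e he =>
    hM ▸ single_le_sum (f := z) (fun _ _ => Nat.zero_le _) he
  have hcard : E.card ≤ M := hM ▸ card_le_sum_of_one_le hz
  have hsum : ∑ e ∈ E, (z e : ℝ) = M := by exact_mod_cast hM
  set R : ℝ := (M + 1).ascFactorial n / (M + 1).ascFactorial 2 with hR
  have hR0 : 0 ≤ R := by positivity
  have h0 : (n ! : ℝ) ≤ 2 * R := by
    have := ascFactorial_le_mul_div (Nat.zero_le M) hn
    rw [zero_add, Nat.one_ascFactorial, Nat.one_ascFactorial, Nat.factorial_two,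
      Nat.cast_ofNat] at this
    exact this
  have hA : ((M + 1).ascFactorial n : ℝ) = (M + 1) * (M + 2) * R := by
    rw [hR, cast_succ_ascFactorial_two]; field_simp
  have hsq := sum_sq_le_of_one_le (z := fun e => (z e : ℝ)) fun e he => by
    exact_mod_cast hz e he
  rw [hsum] at hsq
  have hlin : 14 * (E.card : ℝ) + M ≤ 56 + E.card * M := by
    norm_cast
    have := hE.card_pos
    rcases le_or_gt 14 M with h | h
    · nlinarith
    · interval_cases M <;> omega
  calc ∑ e ∈ E, ((z e + 1).ascFactorial n : ℝ) + 6 * E.card * n !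
      ≤ ∑ e ∈ E, (((z e : ℝ) + 1) * (z e + 2)) * R + 6 * E.card * (2 * R) := by
        refine add_le_add (sum_le_sum fun e he => ?_)
          (mul_le_mul_of_nonneg_left h0 (mul_nonneg (by norm_num) (Nat.cast_nonneg _)))
        rw [← cast_succ_ascFactorial_two]
        exact ascFactorial_le_mul_div (hle e he) hn
    _ = (∑ e ∈ E, (z e : ℝ) ^ 2 + 3 * M + 2 * E.card + 12 * E.card) * R := by
        rw [← sum_mul, ← hsum, mul_sum, mul_comm (2 : ℝ) (E.card : ℝ), ← nsmul_eq_mul E.card,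
          ← sum_const, ← sum_add_distrib, ← sum_add_distrib,
          sum_congr rfl fun e _ => show ((z e : ℝ) + 1) * (z e + 2) = z e ^ 2 + 3 * z e + 2 by ring]
        ring
    _ ≤ ((M + 1) * (M + 2) + 54) * R := mul_le_mul_of_nonneg_right (by linarith) hR0
    _ = _ := by rw [hA]; field_simp

section PartitionMajorant

variable {ι : Type*} [Fintype ι] [DecidableEq ι]

theorem partitionMajorant_insert_le {S : Finset ι} (hS : S.Nonempty) {x : ι} (hx : x ∉ S)
    (v : ι → ℕ) :
    partitionMajorant (insert x S) v ≤ ∑ P ∈ univ.filter (IsSetPartitionOn S),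
      ((P.card - 1)! : ℝ) * 6 ^ P.card * (∏ s ∈ P, ((∑ x ∈ s, v x)! : ℝ)) *
        (∑ s ∈ P, ((∑ x ∈ s, v x + 1).ascFactorial (v x) : ℝ) + 6 * P.card * (v x)!) := by
  have hsub : univ.filter (IsSetPartitionOn (insert x S)) ⊆
      ((univ.filter (IsSetPartitionOn S)).sigma fun P => insertNone P).image
        fun p => adjoinToPartition x p.1 p.2 := fun Q hQ => by
    obtain ⟨P, hP, o, ho, rfl⟩ := IsSetPartitionOn.exists_adjoin hx (mem_filter.mp hQ).2
    exact mem_image.mpr ⟨⟨P, o⟩, mem_sigma.mpr ⟨mem_filter.mpr ⟨mem_univ _, hP⟩, ho⟩, rfl⟩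
  refine (sum_le_sum_of_subset_image hsub fun P =>
    mul_nonneg (by positivity) (prod_nonneg fun _ _ => by positivity)).trans_eq ?_
  rw [sum_sigma]
  refine sum_congr rfl fun P hP => ?_
  have hP := (mem_filter.mp hP).2
  have hxP : ∀ s ∈ P, x ∉ s := fun s hs hxs => hx ((hP.1 s hs).1 hxs)
  rw [sum_insertNone, add_comm, mul_add, mul_sum]
  congr 1
  · refine sum_congr rfl fun s hs => ?_
    have hnot : insert x s ∉ P.erase s := fun h =>
      hxP _ (mem_of_mem_erase h) (mem_insert_self x s)
    rw [adjoinToPartition, card_insert_of_notMem hnot, card_erase_add_one hs, prod_insert hnot,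
      sum_insert (hxP s hs), ← mul_prod_erase P _ hs, add_comm (v x),
      ← Nat.factorial_mul_ascFactorial]
    push_cast
    ring
  · have hnot : {x} ∉ P := fun h => hxP _ h (mem_singleton_self x)
    obtain ⟨k, hk⟩ := Nat.exists_eq_succ_of_ne_zero (hP.nonempty hS).card_ne_zero
    rw [adjoinToPartition, card_insert_of_notMem hnot, prod_insert hnot, sum_singleton, hk,
      Nat.add_sub_cancel, Nat.succ_sub_one, Nat.factorial_succ]
    push_cast
    ring

theorem partitionMajorant_singleton (x : ι) (v : ι → ℕ) :
    partitionMajorant {x} v = 6 * (v x)! := by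
  have : univ.filter (IsSetPartitionOn ({x} : Finset ι)) = {{{x}}} := by
    ext P
    rw [mem_filter, mem_singleton]
    refine ⟨fun h => ?_, fun h => ⟨mem_univ _, h ▸ isSetPartitionOn_singleton ⟨x, by simp⟩⟩⟩
    exact eq_singleton_iff_nonempty_unique_mem.mpr ⟨h.2.nonempty ⟨x, by simp⟩,
      fun s hs => (subset_singleton_iff.mp (h.2.1 s hs).1).resolve_left (h.2.1 s hs).2⟩
  rw [partitionMajorant, this]
  simp

theorem exp_mul_le_exp {M n : ℕ} (hM : 1 ≤ M) (hn : 2 ≤ n) {c : ℝ} (hc : 0 ≤ c) :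
    Real.exp (-c / M) * (1 + 2 * c / ((M + 1) * (M + 2))) ≤ Real.exp (-c / (M + n : ℕ)) := by
  have hM0 : (0 : ℝ) < M := by exact_mod_cast hM
  have h1 : 2 * c / (((M : ℝ) + 1) * (M + 2)) ≤ c / M - c / (M + 2) := by
    rw [div_sub_div _ _ hM0.ne' (by positivity), div_le_div_iff₀ (by positivity) (by positivity)]
    nlinarith [mul_nonneg hc hM0.le, mul_nonneg hc (sq_nonneg (M : ℝ)), mul_nonneg hc hM0.le]
  have h2 : c / (M + n : ℕ) ≤ c / (M + 2) := by
    push_cast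
    gcongr
    exact_mod_cast hn
  calc Real.exp (-c / M) * (1 + 2 * c / ((M + 1) * (M + 2)))
      ≤ Real.exp (-c / M) * Real.exp (2 * c / ((M + 1) * (M + 2))) := by
        gcongr
        linarith [Real.add_one_le_exp (2 * c / (((M : ℝ) + 1) * (M + 2)))]
    _ ≤ _ := by
        rw [← Real.exp_add, Real.exp_le_exp, neg_div, neg_div]
        linarith

theorem partitionMajorant_le {v : ι → ℕ} (hv : ∀ x, 1 ≤ v x) {S : Finset ι} (hS : S.Nonempty) :
    partitionMajorant S v ≤ 6 * Real.exp 27 * (∏ x ∈ S, if v x = 1 then 8 else 1) *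
      Real.exp (-27 / (∑ x ∈ S, v x : ℕ)) * ((∑ x ∈ S, v x)! : ℝ) := by
  induction hS using Finset.Nonempty.cons_induction with
  | singleton x =>
    rw [partitionMajorant_singleton, sum_singleton, prod_singleton]
    have h1 : (1 : ℝ) ≤ v x := by exact_mod_cast hv x
    have h2 : 1 ≤ Real.exp 27 * Real.exp (-27 / v x) := by
      rw [← Real.exp_add, Real.one_le_exp_iff, neg_div, ← sub_eq_add_neg, sub_nonneg]
      exact div_le_self (by norm_num) h1
    have h3 : (1 : ℝ) ≤ if v x = 1 then 8 else 1 := by split_ifs <;> norm_num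
    have h4 := one_le_mul_of_one_le_of_one_le h2 h3
    calc (6 : ℝ) * (v x)! ≤ 6 * (v x)! * (Real.exp 27 * Real.exp (-27 / v x) *
          if v x = 1 then 8 else 1) := le_mul_of_one_le_right (by positivity) h4
      _ = _ := by ring
  | cons x S hx hS ih =>
    rw [cons_eq_insert, sum_insert hx, prod_insert hx, add_comm (v x)]
    set M := ∑ y ∈ S, v y with hM
    have hM1 : 1 ≤ M := (isSetPartitionOn_singleton hS).one_le_sum hv S (mem_singleton_self S)
    set W : ℝ := ∏ y ∈ S, if v y = 1 then 8 else 1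
    have hW : 0 ≤ W := prod_nonneg fun _ _ => by split_ifs <;> norm_num
    have hfac : (((M + v x)! : ℕ) : ℝ) = M ! * (M + 1).ascFactorial (v x) := by
      rw [← Nat.factorial_mul_ascFactorial, Nat.cast_mul]
    have key : ∀ c : ℝ, (∀ P, IsSetPartitionOn S P →
        ∑ s ∈ P, ((∑ x ∈ s, v x + 1).ascFactorial (v x) : ℝ) + 6 * P.card * (v x)! ≤
          c * (M + 1).ascFactorial (v x)) → 0 ≤ c →
        partitionMajorant (insert x S) v ≤ 6 * Real.exp 27 * W * (Real.exp (-27 / M) * c) *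
          (M + v x)! := fun c hc hc0 => by
      calc partitionMajorant (insert x S) v
          ≤ partitionMajorant S v * (c * (M + 1).ascFactorial (v x)) := by
            refine (partitionMajorant_insert_le hS hx v).trans ?_
            rw [partitionMajorant, sum_mul]
            refine sum_le_sum fun P hP => ?_
            exact mul_le_mul_of_nonneg_left (hc P (mem_filter.mp hP).2)
              (mul_nonneg (by positivity) (prod_nonneg fun _ _ => by positivity))
        _ ≤ _ := mul_le_mul_of_nonneg_right ih (by positivity)
        _ = _ := by rw [hfac]; ring
    rcases (hv x).eq_or_lt with h1 | h2
    · rw [if_pos h1.symm]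
      refine (key 8 (fun P hP => sum_ascFactorial_add_le (hP.one_le_sum hv) (hP.sum_sum v)
        (hv x)) (by norm_num)).trans ?_
      have : Real.exp (-27 / M) ≤ Real.exp (-27 / (M + v x : ℕ)) := by
        rw [Real.exp_le_exp, neg_div, neg_div, neg_le_neg_iff]
        gcongr
        exact Nat.le_add_right _ _
      calc _ ≤ 6 * Real.exp 27 * W * (Real.exp (-27 / (M + v x : ℕ)) * 8) * (M + v x)! := by gcongr
        _ = _ := by ring
    · rw [if_neg (by omega), one_mul]
      refine (key _ (fun P hP => sum_ascFactorial_add_le_of_two_le (hP.nonempty hS)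
        (hP.one_le_sum hv) (hP.sum_sum v) h2) (by positivity)).trans ?_
      have := exp_mul_le_exp hM1 h2 (c := 27) (by norm_num)
      norm_num only at this
      gcongr

theorem abs_innerSingle_le {v : ι → ℕ} (hv : ∀ x, 1 ≤ v x) {S : Finset ι} (hS : S.Nonempty) :
    |innerSingle S v| ≤ 2 ^ 45 * (∏ x ∈ S, if v x = 1 then 8 else 1) * ((∑ x ∈ S, v x)! : ℝ) := by
  have hW : (0 : ℝ) ≤ ∏ x ∈ S, if v x = 1 then 8 else 1 :=
    prod_nonneg fun _ _ => by split_ifs <;> norm_num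
  have h1 : Real.exp (-27 / (∑ x ∈ S, v x : ℕ)) ≤ 1 := by
    rw [Real.exp_le_one_iff, neg_div, neg_nonpos]
    positivity
  have h2 : Real.exp 27 ≤ 2 ^ 42 := by
    have := Real.exp_one_lt_d9
    calc Real.exp 27 = Real.exp 1 ^ 27 := by rw [← Real.exp_nat_mul]; norm_num
      _ ≤ 2.7182818286 ^ 27 := by gcongr
      _ ≤ _ := by norm_num
  calc |innerSingle S v| ≤ _ :=
        (abs_innerSingle_le_partitionMajorant hS v).trans (partitionMajorant_le hv hS)
    _ ≤ 6 * 2 ^ 42 * (∏ x ∈ S, if v x = 1 then 8 else 1) * 1 * ((∑ x ∈ S, v x)! : ℝ) := by gcongr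
    _ ≤ _ := by rw [mul_one]; gcongr; norm_num

end PartitionMajorant

section Urn

variable {ε : Type*} [Fintype ε]

theorem factorial_mul_factorial_succ_le {a : ℕ} (ha : 1 ≤ a) (b : ℕ) :
    a ! * (b + 1)! ≤ (a + b)! := by
  induction b with
  | zero => simp
  | succ b ih =>
    rw [Nat.factorial_succ (b + 1), ← add_assoc, Nat.factorial_succ (a + b)]
    calc a ! * ((b + 1 + 1) * (b + 1)!) = (b + 1 + 1) * (a ! * (b + 1)!) := by ring
      _ ≤ (a + b + 1) * (a + b)! := Nat.mul_le_mul (by omega) ih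

theorem prod_factorial_le {κ : Type*} {E : Finset κ} (hE : E.Nonempty) {x : κ → ℕ}
    (hx : ∀ e ∈ E, 1 ≤ x e) {X : ℕ} (hX : X + E.card = ∑ e ∈ E, x e + 1) :
    ∏ e ∈ E, (x e)! ≤ X ! := by
  induction hE using Finset.Nonempty.cons_induction generalizing X with
  | singleton e =>
    rw [card_singleton, sum_singleton, add_left_inj] at hX
    rw [prod_singleton, hX]
  | cons e E he hE ih =>
    rw [prod_cons]
    rw [card_cons, sum_cons] at hX
    have hle := card_le_sum_of_one_le fun f hf => hx f (mem_cons_of_mem hf)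
    have hxe := hx e (mem_cons_self e E)
    obtain ⟨Y, hY⟩ := Nat.exists_eq_add_of_le hle
    refine (Nat.mul_le_mul_left _ (ih (fun f hf => hx f (mem_cons_of_mem hf))
      (X := Y + 1) (by omega))).trans ?_
    rw [show X = x e + Y by omega]
    exact factorial_mul_factorial_succ_le hxe Y

theorem prod_factorial_add_ite [DecidableEq ε] (z : ε → ℕ) (e₀ : ε) (n : ℕ) :
    ∏ e, (z e + if e₀ = e then n else 0)! = (∏ e, (z e)!) * (z e₀ + 1).ascFactorial n := by
  rw [← mul_prod_erase univ _ (mem_univ e₀), ← mul_prod_erase univ (fun e => (z e)!) (mem_univ e₀),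
    if_pos rfl, ← Nat.factorial_mul_ascFactorial,
    prod_congr rfl fun e he => by rw [if_neg (ne_of_mem_erase he).symm, add_zero]]
  ring

theorem sum_ascFactorial_le {m : ℕ} (hm : Fintype.card ε = m + 1) {z : ε → ℕ}
    (hz : ∀ e, 1 ≤ z e) {X : ℕ} (hX : X + m = ∑ e, z e) {t : ℕ} (ht : t ≤ X) {n : ℕ}
    (hn : 1 ≤ n) :
    ∑ e, ((z e + 1).ascFactorial n : ℝ) ≤
      (t + 2 * m + 2) / (t + 1) * (X + 1).ascFactorial n := by
  have hle : ∀ e, z e ≤ X := fun e => by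
    have h1 := card_le_sum_of_one_le fun f (_ : f ∈ univ.erase e) => hz f
    rw [card_erase_of_mem (mem_univ e), Finset.card_univ, hm] at h1
    have h2 := add_sum_erase univ z (mem_univ e)
    omega
  have hsum : ∑ e, (z e : ℝ) = X + m := by exact_mod_cast hX.symm
  set R : ℝ := (X + 1).ascFactorial n / (X + 1).ascFactorial 1 with hR
  have hR0 : 0 ≤ R := by positivity
  have hA : ((X + 1).ascFactorial n : ℝ) = (X + 1) * R := by
    rw [hR, cast_succ_ascFactorial_one]; field_simp
  have ht' : (t : ℝ) ≤ X := by exact_mod_cast ht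
  calc ∑ e, ((z e + 1).ascFactorial n : ℝ) ≤ ∑ e, ((z e : ℝ) + 1) * R := by
        refine sum_le_sum fun e _ => ?_
        rw [← cast_succ_ascFactorial_one]
        exact ascFactorial_le_mul_div (hle e) hn
    _ = (X + 2 * m + 1) * R := by
        rw [← sum_mul, sum_add_distrib, hsum, sum_const, Finset.card_univ, hm, nsmul_eq_mul]
        push_cast
        ring
    _ ≤ (t + 2 * m + 2) / (t + 1) * (X + 1) * R := by
        refine mul_le_mul_of_nonneg_right ?_ hR0
        rw [div_mul_eq_mul_div, le_div_iff₀ (by positivity)]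
        have hmt : (0 : ℝ) ≤ m * (X - t) := mul_nonneg (by positivity) (sub_nonneg.mpr ht')
        have : (0 : ℝ) ≤ m := by positivity
        nlinarith
    _ = _ := by rw [hA]; ring

theorem sum_ascFactorial_le_of_two_le {m : ℕ} (hm : Fintype.card ε = m + 1) {z : ε → ℕ}
    (hz : ∀ e, 1 ≤ z e) {X : ℕ} (hX : X + m = ∑ e, z e) {n : ℕ} (hn : 2 ≤ n) :
    ∑ e, ((z e + 1).ascFactorial n : ℝ) ≤
      (1 + 2 * (3 * m) / ((X + 1) * (X + 2))) * (X + 1).ascFactorial n := by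
  have hle : ∀ e, z e ≤ X := fun e => by
    have h1 := card_le_sum_of_one_le fun f (_ : f ∈ univ.erase e) => hz f
    rw [card_erase_of_mem (mem_univ e), Finset.card_univ, hm] at h1
    have h2 := add_sum_erase univ z (mem_univ e)
    omega
  have hsum : ∑ e, (z e : ℝ) = X + m := by exact_mod_cast hX.symm
  set R : ℝ := (X + 1).ascFactorial n / (X + 1).ascFactorial 2 with hR
  have hR0 : 0 ≤ R := by positivity
  have hA : ((X + 1).ascFactorial n : ℝ) = (X + 1) * (X + 2) * R := by
    rw [hR, cast_succ_ascFactorial_two]; field_simp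
  have hone : ∑ _e : ε, (1 : ℝ) = m + 1 := by
    rw [sum_const, Finset.card_univ, hm, nsmul_eq_mul, mul_one]
    push_cast
    rfl
  have hnn : ∀ e, 0 ≤ (z e : ℝ) - 1 := fun e => sub_nonneg.mpr (by exact_mod_cast hz e)
  have hsq : ∑ e, ((z e : ℝ) - 1) ^ 2 ≤ (∑ e, ((z e : ℝ) - 1)) ^ 2 := by
    rw [sq (∑ e, _), sum_mul]
    refine sum_le_sum fun e _ => ?_
    rw [sq]
    exact mul_le_mul_of_nonneg_left
      (single_le_sum (f := fun e => (z e : ℝ) - 1) (fun e _ => hnn e) (mem_univ e)) (hnn e)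
  rw [sum_sub_distrib, hsum, hone] at hsq
  calc ∑ e, ((z e + 1).ascFactorial n : ℝ)
      ≤ ∑ e, (((z e : ℝ) + 1) * (z e + 2)) * R := by
        refine sum_le_sum fun e _ => ?_
        rw [← cast_succ_ascFactorial_two]
        exact ascFactorial_le_mul_div (hle e) hn
    _ = (∑ e, ((z e : ℝ) - 1) ^ 2 + 5 * (X + m) + (m + 1)) * R := by
        rw [← sum_mul, ← hsum, ← hone, mul_sum, ← sum_add_distrib, ← sum_add_distrib]
        congr 1
        exact sum_congr rfl fun e _ => by ring
    _ ≤ ((X + 1) * (X + 2) + 6 * m) * R := mul_le_mul_of_nonneg_right (by linarith) hR0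
    _ = _ := by rw [hA]; field_simp; ring

theorem sum_fin_prod_factorial_le [DecidableEq ε] {m : ℕ} (hm : Fintype.card ε = m + 1)
    {x : ε → ℕ} (hx : ∀ e, 1 ≤ x e) {n : ℕ} {y : Fin n → ℕ} (hy : ∀ i, 1 ≤ y i) {X : ℕ}
    (hX : X + m = ∑ e, x e + ∑ i, y i) {t : ℕ} (ht : ∑ i, (if y i = 1 then 1 else 0) = t) :
    ∑ f : Fin n → ε, ∏ e, ((x e + ∑ i, if f i = e then y i else 0)! : ℝ) ≤
      (2 * m + 1 + t).choose t * Real.exp (3 * m) * Real.exp (-(3 * m) / X) * X ! := by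
  have hxsum : m + 1 ≤ ∑ e, x e := by
    rw [← hm, ← Finset.card_univ]
    exact card_le_sum_of_one_le fun e _ => hx e
  induction n generalizing X t with
  | zero =>
    rw [Fin.sum_univ_zero] at hX ht
    subst ht
    have hX1 : 1 ≤ X := by omega
    have h1 : 1 ≤ Real.exp (3 * m) * Real.exp (-(3 * m) / X) := by
      rw [← Real.exp_add, Real.one_le_exp_iff, neg_div, ← sub_eq_add_neg, sub_nonneg]
      exact div_le_self (by positivity) (by exact_mod_cast hX1)
    have h2 : ∏ e, (x e)! ≤ X ! := by
      refine prod_factorial_le (card_pos.mp ?_) (fun e _ => hx e) ?_ <;>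
        rw [Finset.card_univ, hm] <;> omega
    have h3 : (∏ e, ((x e)! : ℝ)) ≤ X ! := by exact_mod_cast h2
    simp only [univ_unique, sum_singleton, univ_eq_empty, sum_empty, add_zero,
      Nat.choose_zero_right, Nat.cast_one, one_mul]
    exact h3.trans (le_mul_of_one_le_left (by positivity) h1)
  | succ n ih =>
    rw [Fin.sum_univ_succ] at hX ht
    set y' : Fin n → ℕ := fun i => y i.succ
    replace hX : X + m = ∑ e, x e + (y 0 + ∑ i, y' i) := hX
    set t' := ∑ i, if y' i = 1 then 1 else 0 with ht'
    have hty : t' ≤ ∑ i, y' i := sum_le_sum fun i _ => by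
      have := hy i.succ
      split_ifs <;> simp_all
    obtain ⟨Y, hY⟩ := Nat.exists_eq_add_of_le
      (show m ≤ ∑ e, x e + ∑ i, y' i by omega)
    have hXY : X = Y + y 0 := by omega
    have hYt : t' + 1 ≤ Y := by omega
    have ih' := ih (y := y') (X := Y) (fun i => hy i.succ) (by omega) rfl
    rw [← ht'] at ih'
    have hfac : ((X ! : ℕ) : ℝ) = Y ! * (Y + 1).ascFactorial (y 0) := by
      rw [hXY, ← Nat.factorial_mul_ascFactorial, Nat.cast_mul]
    have key : ∀ c : ℝ, 0 ≤ c → (∀ z : ε → ℕ, (∀ e, 1 ≤ z e) → Y + m = ∑ e, z e →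
        ∑ e, ((z e + 1).ascFactorial (y 0) : ℝ) ≤ c * (Y + 1).ascFactorial (y 0)) →
        ∑ f : Fin (n + 1) → ε, ∏ e, ((x e + ∑ i, if f i = e then y i else 0)! : ℝ) ≤
          ((2 * m + 1 + t').choose t' * Real.exp (3 * m) * Real.exp (-(3 * m) / Y)) * c * X ! :=
        fun c hc hstep => by
      rw [← (Fin.consEquiv fun _ => ε).sum_comp, Fintype.sum_prod_type, sum_comm]
      calc _ = ∑ f : Fin n → ε, (∏ e, ((x e + ∑ i, if f i = e then y' i else 0)! : ℝ)) *
            ∑ e₀, ((x e₀ + (∑ i, if f i = e₀ then y' i else 0) + 1).ascFactorial (y 0) : ℝ) := by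
            refine sum_congr rfl fun f _ => ?_
            rw [mul_sum]
            refine sum_congr rfl fun e₀ _ => ?_
            have := prod_factorial_add_ite (fun e => x e + ∑ i, if f i = e then y' i else 0) e₀
              (y 0)
            rw [← Nat.cast_prod, ← Nat.cast_prod, ← Nat.cast_mul, ← this]
            congr 1
            refine prod_congr rfl fun e _ => ?_
            simp only [Fin.consEquiv_apply, Fin.sum_univ_succ, Fin.cons_zero, Fin.cons_succ, y']
            congr 1
            ring
        _ ≤ ∑ f : Fin n → ε, (∏ e, ((x e + ∑ i, if f i = e then y' i else 0)! : ℝ)) *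
              (c * (Y + 1).ascFactorial (y 0)) := by
            refine sum_le_sum fun f _ => mul_le_mul_of_nonneg_left (hstep _ (fun e => ?_) ?_)
              (prod_nonneg fun _ _ => by positivity)
            · exact (hx e).trans (Nat.le_add_right _ _)
            · rw [sum_add_distrib, sum_comm]
              simp only [sum_ite_eq, mem_univ, if_true]
              omega
        _ ≤ _ := by
            rw [← sum_mul]
            refine (mul_le_mul_of_nonneg_right ih' (by positivity)).trans_eq ?_
            rw [hfac]
            ring
    have hexp : Real.exp (-(3 * m) / Y) ≤ Real.exp (-(3 * m) / X) := by
      have hY0 : (0 : ℝ) < Y := by exact_mod_cast (show 0 < Y by omega)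
      rw [Real.exp_le_exp, neg_div, neg_div, neg_le_neg_iff]
      gcongr
      omega
    rcases (hy 0).eq_or_lt with h1 | h2
    · rw [if_pos h1.symm, add_comm] at ht
      have ht1 : t = t' + 1 := ht.symm
      refine (key ((t' + 2 * m + 2) / (t' + 1)) (by positivity) fun z hz hzs =>
        sum_ascFactorial_le hm hz hzs (by omega) (hy 0)).trans ?_
      have hch : ((2 * m + 1 + t').choose t' : ℝ) * ((t' + 2 * m + 2) / (t' + 1)) =
          (2 * m + 1 + t).choose t := by
        rw [ht1, ← mul_div_assoc, div_eq_iff (by positivity)]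
        have := Nat.add_one_mul_choose_eq (2 * m + 1 + t') t'
        rw [← add_assoc]
        have h : ((2 * m + 1 + t' + 1 : ℕ) : ℝ) * (2 * m + 1 + t').choose t' =
          (2 * m + 1 + t' + 1).choose (t' + 1) * (t' + 1 : ℕ) := by exact_mod_cast this
        push_cast at h
        rw [← h]
        ring
      calc _ = ((2 * m + 1 + t').choose t' : ℝ) * ((t' + 2 * m + 2) / (t' + 1)) *
            Real.exp (3 * m) * Real.exp (-(3 * m) / Y) * X ! := by ring
        _ ≤ _ := by rw [hch]; gcongr
    · rw [if_neg (by omega), zero_add] at ht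
      have ht1 : t = t' := ht.symm
      subst ht1
      refine (key _ (by positivity) fun z hz hzs =>
        sum_ascFactorial_le_of_two_le hm hz hzs h2).trans ?_
      rw [mul_assoc _ (Real.exp (-(3 * m) / Y)), hXY]
      have := exp_mul_le_exp (M := Y) (by omega) h2 (c := 3 * m) (by positivity)
      gcongr

theorem sum_prod_factorial_le [DecidableEq ε] {m : ℕ} (hm : Fintype.card ε = m + 1)
    {x : ε → ℕ} (hx : ∀ e, 1 ≤ x e) {κ : Type*} [Fintype κ] [DecidableEq κ] {y : κ → ℕ}
    (hy : ∀ i, 1 ≤ y i) {X : ℕ}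
    (hX : X + m = ∑ e, x e + ∑ i, y i) {t : ℕ} (ht : (univ.filter fun i => y i = 1).card ≤ t) :
    ∑ f : κ → ε, ∏ e, ((x e + ∑ i, if f i = e then y i else 0)! : ℝ) ≤
      2 ^ (7 * m + 1 + t) * X ! := by
  have σ := Fintype.equivFin κ
  have h := sum_fin_prod_factorial_le hm hx (y := y ∘ σ.symm) (fun i => hy _) (X := X)
    (by rw [hX, ← σ.symm.sum_comp y]; rfl) rfl
  rw [← (σ.arrowCongr (Equiv.refl ε)).sum_comp] at h
  have hcount : ∑ i, (if (y ∘ σ.symm) i = 1 then 1 else 0) ≤ t := by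
    simp only [Function.comp_apply]
    rw [σ.symm.sum_comp fun i => if y i = 1 then 1 else 0, ← card_filter]
    exact ht
  set t' := ∑ i, (if (y ∘ σ.symm) i = 1 then 1 else 0)
  have hexp : Real.exp (3 * m) ≤ 2 ^ (5 * m) := by
    have := Real.exp_one_lt_d9
    rw [mul_comm, Real.exp_nat_mul, pow_mul]
    refine pow_le_pow_left₀ (Real.exp_pos _).le ?_ _
    calc Real.exp 3 = Real.exp 1 ^ 3 := by rw [← Real.exp_nat_mul]; norm_num
      _ ≤ 2.7182818286 ^ 3 := by gcongr
      _ ≤ _ := by norm_num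
  have hexp1 : Real.exp (-(3 * m) / X) ≤ 1 := by
    rw [Real.exp_le_one_iff, neg_div, neg_nonpos]
    positivity
  have hch : ((2 * m + 1 + t').choose t' : ℝ) ≤ 2 ^ (2 * m + 1 + t) := by
    calc ((2 * m + 1 + t').choose t' : ℝ) ≤ 2 ^ (2 * m + 1 + t') := by
          exact_mod_cast Nat.choose_le_two_pow _ _
      _ ≤ _ := pow_le_pow_right₀ (by norm_num) (by omega)
  calc _ = ∑ f : κ → ε, ∏ e, ((x e + ∑ i, if (σ.arrowCongr (Equiv.refl ε) f) i = e then
          (y ∘ σ.symm) i else 0)! : ℝ) := by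
        refine sum_congr rfl fun f _ => prod_congr rfl fun e _ => ?_
        rw [← σ.symm.sum_comp fun i => if f i = e then y i else 0]
        rfl
    _ ≤ _ := h
    _ ≤ 2 ^ (2 * m + 1 + t) * 2 ^ (5 * m) * 1 * X ! := by gcongr
    _ = _ := by rw [mul_one, ← pow_add]; congr 2; ring

end Urn

section Tree

theorem SimpleGraph.Connected.exists_bijective_parent_edge {V ι : Type*} [Fintype V] [Fintype ι]
    {Γ : SimpleGraph V} (hΓ : Γ.Connected) {ends : ι → Sym2 V}
    (hadj : ∀ u w, Γ.Adj u w → ∃ x, ends x = s(u, w))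
    (hcard : Fintype.card V = Fintype.card ι + 1) (r : V) :
    ∃ e : {v // v ≠ r} → ι, Function.Bijective e ∧ ∀ v, v.1 ∈ ends (e v) := by
  have hparent : ∀ v : {v // v ≠ r}, ∃ x w, ends x = s(v.1, w) ∧ Γ.dist w r < Γ.dist v.1 r := by
      rintro ⟨v, hv⟩
      obtain ⟨p, hp⟩ := (hΓ.preconnected v r).exists_walk_length_eq_dist
      cases p with
      | nil => exact absurd rfl hv
      | @cons _ w _ h q =>
        obtain ⟨x, hx⟩ := hadj _ _ h
        refine ⟨x, w, hx, ?_⟩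
        rw [← hp, SimpleGraph.Walk.length_cons]
        exact Nat.lt_succ_of_le (SimpleGraph.dist_le q)
  choose e w hew hlt using hparent
  have hinj : Function.Injective e := fun u v huv => by
    have h := (hew u).symm.trans (huv ▸ hew v)
    rcases Sym2.eq_iff.mp h with ⟨h1, -⟩ | ⟨h1, h2⟩
    · exact Subtype.ext h1
    · have hu := hlt u
      have hv := hlt v
      rw [h2, h1] at hu
      exact absurd hu hv.not_gt
  refine ⟨e, (Fintype.bijective_iff_injective_and_card e).mpr ⟨hinj, ?_⟩, fun v => ?_⟩
  · rw [Fintype.card_subtype_compl, Fintype.card_subtype_eq, hcard, Nat.add_sub_cancel]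
  · rw [hew]
    exact Sym2.mem_mk_left _ _

variable {ι G : Type*} [Fintype ι] [DecidableEq ι]

theorem IsSetPartitionOn.exists_block {P : Finset (Finset ι)} (hP : IsSetPartitionOn univ P) :
    ∃ c : ι → P, ∀ x (s : P), x ∈ s.1 ↔ c x = s := by
  choose c hc using fun x => (hP.2 x (mem_univ x)).exists
  refine ⟨fun x => ⟨c x, (hc x).1⟩, fun x s => ⟨fun h => ?_, ?_⟩⟩
  · exact Subtype.ext (hP.eq_of_mem (hc x).1 s.2 (hc x).2 h)
  · rintro rfl
    exact (hc x).2

theorem IsComplementary.connected {g : ι → G} (hg : Function.Surjective g) [Nonempty ι]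
    {ρ α : Finset (Finset ι)} (hρ : ∀ s ∈ ρ, ∃ γ, ∀ x, x ∈ s ↔ g x = γ)
    (hα : IsSetPartitionOn univ α) (hc : IsComplementary ρ α) {c : ι → α}
    (hcα : ∀ x (s : α), x ∈ s.1 ↔ c x = s) :
    (SimpleGraph.fromEdgeSet (Set.range fun x =>
      (s(Sum.inl (g x), Sum.inr (c x)) : Sym2 (G ⊕ α)))).Connected := by
  set Γ := SimpleGraph.fromEdgeSet (Set.range fun x =>
    (s(Sum.inl (g x), Sum.inr (c x)) : Sym2 (G ⊕ α)))
  have hadj : ∀ x, Γ.Adj (Sum.inl (g x)) (Sum.inr (c x)) := fun x =>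
    (SimpleGraph.fromEdgeSet_adj _).mpr ⟨⟨x, rfl⟩, Sum.inl_ne_inr⟩
  set cls : ι → Finset ι := fun x =>
    univ.filter fun y => Γ.Reachable (Sum.inl (g x)) (Sum.inl (g y)) with hcls
  have hmem : ∀ x y, y ∈ cls x ↔ Γ.Reachable (Sum.inl (g x)) (Sum.inl (g y)) := fun x y => by
    simp [hcls]
  have hpart : IsSetPartitionOn univ (univ.image cls) := by
    refine ⟨fun s hs => ⟨subset_univ _, ?_⟩, fun x _ =>
      ⟨cls x, ⟨mem_image_of_mem _ (mem_univ x), (hmem x x).mpr .rfl⟩, ?_⟩⟩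
    · obtain ⟨x, -, rfl⟩ := mem_image.mp hs
      exact ne_empty_of_mem ((hmem x x).mpr .rfl)
    · rintro s ⟨hs, hxs⟩
      obtain ⟨y, -, rfl⟩ := mem_image.mp hs
      rw [hmem] at hxs
      ext z
      rw [hmem, hmem]
      exact ⟨hxs.symm.trans, hxs.trans⟩
  have hone := hc.2 _ hpart
    (fun s hs => by
      obtain ⟨γ, hγ⟩ := hρ s hs
      obtain ⟨x, rfl⟩ := hg γ
      refine ⟨cls x, mem_image_of_mem _ (mem_univ x), fun y hy => ?_⟩
      rw [hmem, (hγ y).mp hy])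
    (fun s hs => by
      obtain ⟨x, hx⟩ := nonempty_iff_ne_empty.mpr (hα.1 s hs).2
      refine ⟨cls x, mem_image_of_mem _ (mem_univ x), fun y hy => ?_⟩
      rw [hmem]
      have h1 := hadj x
      have h2 := hadj y
      rw [(hcα x ⟨s, hs⟩).mp hx] at h1
      rw [(hcα y ⟨s, hs⟩).mp hy] at h2
      exact h1.reachable.trans h2.reachable.symm)
  have hll : ∀ x y, Γ.Reachable (Sum.inl (g x)) (Sum.inl (g y)) := fun x y => by
    have h := mem_image_of_mem cls (mem_univ x)
    rw [hone, mem_singleton] at h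
    rw [← hmem, h]
    exact mem_univ y
  obtain ⟨x₀⟩ := ‹Nonempty ι›
  have hroot : ∀ v, Γ.Reachable (Sum.inl (g x₀)) v := by
    rintro (γ | s)
    · obtain ⟨x, rfl⟩ := hg γ
      exact hll x₀ x
    · obtain ⟨x, hx⟩ := nonempty_iff_ne_empty.mpr (hα.1 s.1 s.2).2
      rw [← (hcα x s).mp hx]
      exact (hll x₀ x).trans (hadj x).reachable
  have : Nonempty (G ⊕ α) := ⟨Sum.inl (g x₀)⟩
  exact ⟨fun u v => (hroot u).symm.trans (hroot v)⟩

/-- The set partition whose components are represented by the elements `e` outside the range of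
`Q`, the component of `e` containing `e` and all `Q γ` with `f γ = e`. -/
noncomputable def attachedPartition {κ : Type*} [Fintype κ] (Q : κ → ι)
    (f : κ → {x // x ∉ Set.range Q}) : Finset (Finset ι) :=
  univ.image fun e => insert e.1 ((univ.filter fun γ => f γ = e).image Q)

theorem prod_attachedPartition {κ M : Type*} [Fintype κ] [CommMonoid M] {Q : κ → ι}
    (hQ : Function.Injective Q) (f : κ → {x // x ∉ Set.range Q}) (v : ι → ℕ) (F : ℕ → M) :
    ∏ s ∈ attachedPartition Q f, F (∑ x ∈ s, v x) =
      ∏ e, F (v e.1 + ∑ γ, if f γ = e then v (Q γ) else 0) := by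
  have hnot : ∀ e e' : {x // x ∉ Set.range Q},
      e.1 ∉ (univ.filter fun γ => f γ = e').image Q := fun e e' h => by
    obtain ⟨γ, -, hγ⟩ := mem_image.mp h
    exact e.2 ⟨γ, hγ⟩
  rw [attachedPartition, prod_image]
  · refine prod_congr rfl fun e _ => ?_
    rw [sum_insert (hnot e e), sum_image hQ.injOn, sum_filter]
  · intro e _ e' _ h
    have he : e.1 ∈ insert e'.1 ((univ.filter fun γ => f γ = e').image Q) := by
      have := mem_insert_self e.1 ((univ.filter fun γ => f γ = e).image Q)
      rwa [show insert e.1 _ = _ from h] at this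
    exact Subtype.ext ((mem_insert.mp he).resolve_right (hnot e e'))

theorem IsComplementary.exists_attachedPartition_eq [Fintype G] {g : ι → G}
    (hg : Function.Surjective g) [Nonempty ι] {ρ α : Finset (Finset ι)}
    (hρ : ∀ s ∈ ρ, ∃ γ, ∀ x, x ∈ s ↔ g x = γ)
    (hρcard : ρ.card = Fintype.card G) (hα : IsSetPartitionOn univ α)
    (hc : IsComplementary ρ α) (γ₀ : G) :
    ∃ (Q : {γ // γ ≠ γ₀} → ι) (f : {γ // γ ≠ γ₀} → {x // x ∉ Set.range Q}),
      (∀ γ, g (Q γ) = γ) ∧ attachedPartition Q f = α := by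
  obtain ⟨c, hcα⟩ := hα.exists_block
  obtain ⟨E, hE, hends⟩ := (hc.connected hg hρ hα hcα).exists_bijective_parent_edge
    (ends := fun x => s(Sum.inl (g x), Sum.inr (c x)))
    (fun u w h => ((SimpleGraph.fromEdgeSet_adj _).mp h).1)
    (by rw [Fintype.card_sum, Fintype.card_coe, ← hρcard, hc.1]) (Sum.inl γ₀)
  set Q : {γ // γ ≠ γ₀} → ι := fun γ => E ⟨Sum.inl γ.1, fun h => γ.2 (Sum.inl_injective h)⟩
  set p : α → ι := fun s => E ⟨Sum.inr s, Sum.inr_ne_inl⟩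
  have hgQ : ∀ γ, g (Q γ) = γ := fun γ => by
    have := Sym2.mem_iff.mp (hends ⟨Sum.inl γ.1, fun h => γ.2 (Sum.inl_injective h)⟩)
    exact (Sum.inl_injective (this.resolve_right Sum.inl_ne_inr)).symm
  have hcp : ∀ s, c (p s) = s := fun s => by
    have := Sym2.mem_iff.mp (hends ⟨Sum.inr s, Sum.inr_ne_inl⟩)
    exact (Sum.inr_injective (this.resolve_left Sum.inr_ne_inl)).symm
  have hpQ : ∀ s, p s ∉ Set.range Q := by
    rintro s ⟨γ, hγ⟩
    simpa using hE.1 hγ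
  have hor : ∀ x, (∃ γ, Q γ = x) ∨ ∃ s, p s = x := fun x => by
    obtain ⟨⟨γ | s, h⟩, rfl⟩ := hE.2 x
    · exact Or.inl ⟨⟨γ, fun h' => h (h' ▸ rfl)⟩, rfl⟩
    · exact Or.inr ⟨s, rfl⟩
  have hblock : ∀ s : α, insert (p s) ((univ.filter fun γ =>
      (⟨p (c (Q γ)), hpQ _⟩ : {x // x ∉ Set.range Q}) = ⟨p s, hpQ s⟩).image Q) = s.1 := fun s => by
    ext y
    rw [hcα, mem_insert, mem_image]
    constructor
    · rintro (rfl | ⟨γ, hγ, rfl⟩)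
      · exact hcp s
      · have := congrArg c (Subtype.ext_iff.mp (mem_filter.mp hγ).2)
        rwa [hcp, hcp] at this
    · rintro rfl
      rcases hor y with ⟨γ, rfl⟩ | ⟨t, rfl⟩
      · exact Or.inr ⟨γ, mem_filter.mpr ⟨mem_univ _, rfl⟩, rfl⟩
      · exact Or.inl (by rw [hcp])
  refine ⟨Q, fun γ => ⟨p (c (Q γ)), hpQ _⟩, hgQ, ?_⟩
  ext s
  rw [attachedPartition, mem_image]
  constructor
  · rintro ⟨⟨e, he⟩, -, rfl⟩
    obtain ⟨t, rfl⟩ := (hor e).resolve_left he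
    rw [hblock]
    exact t.2
  · intro hs
    exact ⟨⟨p ⟨s, hs⟩, hpQ _⟩, mem_univ _, hblock ⟨s, hs⟩⟩

end Tree

section Assembly

variable {ι G : Type*} [Fintype ι] [Fintype G]

theorem card_sections_le {g : ι → G} (hg : Function.Surjective g) {m : ℕ}
    (hm : Fintype.card ι = Fintype.card G + m) (γ₀ : G) :
    (univ.filter fun Q : {γ // γ ≠ γ₀} → ι => ∀ γ, g (Q γ) = γ).card ≤ 2 ^ m := by
  have hfib : ∀ γ, 1 ≤ (univ.filter fun x => g x = γ).card := fun γ => by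
    obtain ⟨x, hx⟩ := hg γ
    exact card_pos.mpr ⟨x, mem_filter.mpr ⟨mem_univ x, hx⟩⟩
  have hsum : ∑ γ, ((univ.filter fun x => g x = γ).card - 1) = m := by
    have h1 := card_eq_sum_card_fiberwise (f := g) (s := univ) (t := univ) fun x _ => mem_univ _
    have h2 : ∑ γ, ((univ.filter fun x => g x = γ).card - 1 + 1) = Fintype.card ι := by
      rw [← Finset.card_univ, h1]
      exact sum_congr rfl fun γ _ => Nat.sub_add_cancel (hfib γ)
    rw [sum_add_distrib, sum_const, Finset.card_univ, smul_eq_mul, mul_one] at h2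
    omega
  have heq : (univ.filter fun Q : {γ // γ ≠ γ₀} → ι => ∀ γ, g (Q γ) = γ) =
      Fintype.piFinset fun γ : {γ // γ ≠ γ₀} => univ.filter fun x => g x = γ := by
    ext Q
    simp
  rw [heq, Fintype.card_piFinset, ← hsum, ← prod_pow_eq_pow_sum,
    ← Fintype.prod_subtype_mul_prod_subtype (fun γ => γ ≠ γ₀)]
  refine (prod_le_prod' fun γ _ => ?_).trans (Nat.le_mul_of_pos_right _ (by positivity))
  have := Nat.lt_two_pow_self (n := (univ.filter fun x => g x = γ.1).card - 1)
  have := hfib γ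
  omega

theorem sum_complementary_prod_factorial_le [DecidableEq ι] {g : ι → G} (hg : Function.Surjective g)
    {ρ : Finset (Finset ι)} (hρ : ∀ s ∈ ρ, ∃ γ, ∀ x, x ∈ s ↔ g x = γ)
    (hρcard : ρ.card = Fintype.card G) {v : ι → ℕ} (hv : ∀ x, 1 ≤ v x) (γ₀ : G) {m : ℕ}
    (hm : Fintype.card ι = Fintype.card G + m) {X : ℕ} (hX : X + m = ∑ x, v x) {T : Finset G}
    (hT : ∀ x, v x = 1 → g x ∈ T) :
    ∑ α ∈ univ.filter (fun α : Finset (Finset ι) =>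
        IsSetPartitionOn univ α ∧ IsComplementary ρ α),
      ∏ s ∈ α, ((∑ x ∈ s, v x)! : ℝ) ≤ 2 ^ (8 * m + 1 + T.card) * X ! := by
  have : Nonempty ι := ⟨(hg γ₀).choose⟩
  have hsub : (univ.filter fun α : Finset (Finset ι) =>
      IsSetPartitionOn univ α ∧ IsComplementary ρ α) ⊆
      ((univ.filter fun Q : {γ // γ ≠ γ₀} → ι => ∀ γ, g (Q γ) = γ).sigma
        fun Q => (univ : Finset ({γ // γ ≠ γ₀} → {x // x ∉ Set.range Q}))).image
        fun k => attachedPartition k.1 k.2 := fun α hα => by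
    obtain ⟨hα, hc⟩ := (mem_filter.mp hα).2
    obtain ⟨Q, f, hQ, hf⟩ := hc.exists_attachedPartition_eq hg hρ hρcard hα γ₀
    exact mem_image.mpr ⟨⟨Q, f⟩,
      mem_sigma.mpr ⟨mem_filter.mpr ⟨mem_univ _, hQ⟩, mem_univ _⟩, hf⟩
  refine (sum_le_sum_of_subset_image (F := fun α => ∏ s ∈ α, ((∑ x ∈ s, v x)! : ℝ)) hsub
    fun α => prod_nonneg fun _ _ => by positivity).trans ?_
  rw [sum_sigma]
  have hstep : ∀ Q ∈ univ.filter fun Q : {γ // γ ≠ γ₀} → ι => ∀ γ, g (Q γ) = γ,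
      ∑ f, ∏ s ∈ attachedPartition Q f, ((∑ x ∈ s, v x)! : ℝ) ≤ 2 ^ (7 * m + 1 + T.card) * X ! :=
    fun Q hQ => by
    replace hQ := (mem_filter.mp hQ).2
    have hinj : Function.Injective Q := fun γ γ' h =>
      Subtype.ext (by rw [← hQ γ, h, hQ γ'])
    rw [sum_congr rfl fun f _ => prod_attachedPartition hinj f v fun n => (n ! : ℝ)]
    have hsplit : ∑ x, v x = ∑ e : {x // x ∉ Set.range Q}, v e.1 + ∑ γ, v (Q γ) := by
      rw [← Fintype.sum_subtype_add_sum_subtype (fun x => x ∈ Set.range Q), add_comm]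
      have h : ∑ γ, v (Q γ) = ∑ x : {x // x ∈ Set.range Q}, v x.1 :=
        Fintype.sum_bijective (fun γ => (⟨Q γ, γ, rfl⟩ : {x // x ∈ Set.range Q}))
          ⟨fun γ γ' h => hinj (congrArg Subtype.val h), fun ⟨_, γ, hγ⟩ => ⟨γ, Subtype.ext hγ⟩⟩
          _ _ fun _ => rfl
      rw [h]
      congr!
    have hcard : Fintype.card {x // x ∉ Set.range Q} = m + 1 := by
      have h1 : Fintype.card {x // x ∈ Set.range Q} = Fintype.card {γ // γ ≠ γ₀} :=
        (Fintype.card_congr (Equiv.ofInjective Q hinj)).symm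
      have h2 : 0 < Fintype.card G := Fintype.card_pos_iff.mpr ⟨γ₀⟩
      rw [Fintype.card_subtype_compl, h1, Fintype.card_subtype_compl, Fintype.card_subtype_eq]
      omega
    refine sum_prod_factorial_le hcard (x := fun e => v e.1) (fun e => hv _)
      (y := fun γ => v (Q γ)) (fun γ => hv _) (hX.trans hsplit) ?_
    refine card_le_card_of_injOn Subtype.val (fun γ hγ => ?_) Subtype.val_injective.injOn
    exact hQ γ ▸ hT (Q γ) (mem_filter.mp hγ).2
  refine (sum_le_sum hstep).trans ?_
  rw [sum_const, nsmul_eq_mul, show 8 * m + 1 + T.card = m + (7 * m + 1 + T.card) by ring,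
    pow_add 2 m, mul_assoc]
  exact mul_le_mul_of_nonneg_right (by exact_mod_cast card_sections_le hg hm γ₀) (by positivity)

theorem abs_innerMulti_le_of_surjective [DecidableEq ι] {g : ι → G} (hg : Function.Surjective g)
    {ρ : Finset (Finset ι)} (hρ : ∀ s ∈ ρ, ∃ γ, ∀ x, x ∈ s ↔ g x = γ)
    (hρcard : ρ.card = Fintype.card G) {v : ι → ℕ} (hv : ∀ x, 1 ≤ v x) (γ₀ : G) {m : ℕ}
    (hm : Fintype.card ι = Fintype.card G + m) {X : ℕ} (hX : X + m = ∑ x, v x) {T : Finset G}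
    (hT : ∀ x, v x = 1 → g x ∈ T) :
    |innerMulti ρ v| ≤
      2 ^ (53 * m + 46 + T.card) * (∏ x, if v x = 1 then 8 else 1) * X ! := by
  calc |innerMulti ρ v|
      ≤ ∑ α ∈ univ.filter (fun α : Finset (Finset ι) =>
          IsSetPartitionOn univ α ∧ IsComplementary ρ α), ∏ s ∈ α, |innerSingle s v| :=
        (abs_sum_le_sum_abs _ _).trans_eq (sum_congr rfl fun α _ => abs_prod _ _)
    _ ≤ ∑ α ∈ univ.filter (fun α : Finset (Finset ι) =>
          IsSetPartitionOn univ α ∧ IsComplementary ρ α),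
          2 ^ (45 * (m + 1)) * (∏ x, if v x = 1 then 8 else 1) *
            ∏ s ∈ α, ((∑ x ∈ s, v x)! : ℝ) := by
        refine sum_le_sum fun α hα => ?_
        obtain ⟨hα, hc⟩ := (mem_filter.mp hα).2
        have hαcard : α.card = m + 1 := by
          have := hc.1
          omega
        refine (prod_le_prod (fun _ _ => abs_nonneg _) fun s hs =>
          abs_innerSingle_le hv (nonempty_iff_ne_empty.mpr (hα.1 s hs).2)).trans_eq ?_
        rw [prod_mul_distrib, prod_mul_distrib, prod_const, hα.prod_prod, hαcard, ← pow_mul]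
    _ ≤ 2 ^ (45 * (m + 1)) * (∏ x, if v x = 1 then 8 else 1) *
          (2 ^ (8 * m + 1 + T.card) * X !) := by
        rw [← mul_sum]
        refine mul_le_mul_of_nonneg_left
          (sum_complementary_prod_factorial_le hg hρ hρcard hv γ₀ hm hX hT)
          (mul_nonneg (by positivity) (prod_nonneg fun _ _ => ?_))
        split_ifs <;> norm_num
    _ = _ := by
        rw [show 53 * m + 46 + T.card = 45 * (m + 1) + (8 * m + 1 + T.card) by ring,
          pow_add 2 (45 * _)]
        ring

end Assembly

/-- Let `a ≥ 1` and `b ≥ 0`; let `λ^(1), …, λ^(a)` be partitions of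
lengths `ℓ₁, …, ℓ_a ≥ 2` (nonincreasing tuples of positive integers) and let
`D₁, …, D_b ≥ 2`.  With `L = Σ ℓ_i`, `|λ| = Σ |λ^(i)|`, and `B = Σ D_j`, one has
`|⟨p_{λ^(1)} | ⋯ | p_{λ^(a)} | p_{D₁} | ⋯ | p_{D_b}⟩| ≤ 2^{89L+5} (|λ| + a + B − L)!`.
Here the ground set is `(Σ i, Fin ℓ_i) ⊕ Fin b`, the set partition `ρ` consists of the
fibers of the grouping map (one component per `λ^(i)` and a singleton per `D_j`), and
the value map records the parts. -/
theorem abs_innerMulti_le (a b : ℕ) (ha : 1 ≤ a) (l : Fin a → ℕ) (hl : ∀ i, 2 ≤ l i)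
    (lam : (i : Fin a) → Fin (l i) → ℕ)
    (hpos : ∀ i j, 0 < lam i j)
    (hanti : ∀ (i : Fin a), ∀ j j' : Fin (l i), j ≤ j' → lam i j' ≤ lam i j)
    (D : Fin b → ℕ) (hD : ∀ j, 2 ≤ D j) :
    |innerMulti
        (Finset.univ.image fun g : Fin a ⊕ Fin b =>
          Finset.univ.filter fun x : (Σ i : Fin a, Fin (l i)) ⊕ Fin b =>
            Sum.map Sigma.fst id x = g)
        (Sum.elim (fun x => lam x.1 x.2) D)| ≤
      2 ^ (89 * (∑ i, l i) + 5) *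
        (((∑ i, ∑ j, lam i j) + a + (∑ j, D j) - (∑ i, l i))! : ℝ) := by
  set g : (Σ i : Fin a, Fin (l i)) ⊕ Fin b → Fin a ⊕ Fin b := Sum.map Sigma.fst id
  set v : (Σ i : Fin a, Fin (l i)) ⊕ Fin b → ℕ := Sum.elim (fun x => lam x.1 x.2) D
  have hg : Function.Surjective g := by
    rintro (i | j)
    · exact ⟨Sum.inl ⟨i, ⟨0, by have := hl i; omega⟩⟩, rfl⟩
    · exact ⟨Sum.inr j, rfl⟩
  have hv : ∀ x, 1 ≤ v x := by
    rintro (x | j)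
    · exact hpos x.1 x.2
    · exact one_le_two.trans (hD j)
  have hLa : a ≤ ∑ i, l i := by
    simpa using card_le_sum_of_one_le fun i (_ : i ∈ univ) => one_le_two.trans (hl i)
  obtain ⟨m, hm⟩ := Nat.exists_eq_add_of_le hLa
  have hlam : ∑ i, l i ≤ ∑ i, ∑ j, lam i j := sum_le_sum fun i _ => by
    simpa using card_le_sum_of_one_le fun j (_ : j ∈ univ) => hpos i j
  have hsum : ∑ x, v x = ∑ i, ∑ j, lam i j + ∑ j, D j := by
    rw [Fintype.sum_sum_type, Fintype.sum_sigma]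
    rfl
  have hone : ∏ x, (if v x = 1 then (8 : ℝ) else 1) ≤ 8 ^ ∑ i, l i := by
    have h1 : ∀ j, (if v (Sum.inr j) = 1 then (8 : ℝ) else 1) = 1 := fun j =>
      if_neg fun h => absurd (hD j) (by rw [show D j = 1 from h]; norm_num)
    rw [Fintype.prod_sum_type, prod_congr rfl fun j _ => h1 j, prod_const_one, mul_one]
    refine (prod_le_prod (fun _ _ => ?_) fun x _ => ?_).trans_eq
      (b := ∏ _x : (Σ i, Fin (l i)), (8 : ℝ)) ?_
    · split_ifs <;> norm_num
    · split_ifs <;> norm_num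
    · rw [prod_const, Finset.card_univ, Fintype.card_sigma]
      simp
  have key := abs_innerMulti_le_of_surjective hg
    (ρ := univ.image fun γ => univ.filter fun x => g x = γ)
    (fun s hs => by
      obtain ⟨γ, -, rfl⟩ := mem_image.mp hs
      exact ⟨γ, fun x => by simp⟩)
    (by
      rw [Finset.card_image_of_injective, Finset.card_univ]
      intro γ γ' h
      obtain ⟨x, rfl⟩ := hg γ
      have hx : x ∈ univ.filter fun y => g y = g x := mem_filter.mpr ⟨mem_univ x, rfl⟩
      exact (mem_filter.mp ((Finset.ext_iff.mp h x).mp hx)).2)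
    hv (Sum.inl ⟨0, ha⟩) (m := m)
    (by simp only [Fintype.card_sum, Fintype.card_sigma, Fintype.card_fin]; omega)
    (X := (∑ i, ∑ j, lam i j) + a + (∑ j, D j) - (∑ i, l i)) (by omega)
    (T := univ.image Sum.inl)
    (by
      rintro (x | j) hx
      · exact mem_image_of_mem _ (mem_univ x.1)
      · exact absurd (hD j) (by rw [show D j = 1 from hx]; norm_num))
  have hT : (univ.image (Sum.inl : Fin a → Fin a ⊕ Fin b)).card ≤ a :=
    card_image_le.trans_eq (Finset.card_fin a)
  refine le_trans ?_ (key.trans ?_)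
  · exact le_of_eq (by congr!)
  · refine mul_le_mul_of_nonneg_right ?_ (Nat.cast_nonneg _)
    calc _ ≤ (2 : ℝ) ^ (53 * m + 46 + a) * 8 ^ ∑ i, l i := by
          gcongr
          norm_num
      _ = 2 ^ (53 * m + 46 + a + 3 * ∑ i, l i) := by
          rw [pow_add _ _ (3 * _), pow_mul 2 3]; norm_num
      _ ≤ _ := pow_le_pow_right₀ (by norm_num) (by omega)
end
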